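/- arXiv:2507.13995 — 5 statements merged into one kernel-verified Lean document; each statement's English description precedes it below -/
import Mathlib

section
/- For every real number z with 0 < z < 1, the improper integral ∫₀¹ x^(−1/2) (1 − z·x)^(−1/2) dx equals 2·arcsin(√z)/√z. -/
open MeasureTheory Real

theorem euler_integral_arcsin (z : ℝ) (hz0 : 0 < z) (hz1 : z < 1) :
    ∫ x in (0:ℝ)..1, x ^ (-(1/2) : ℝ) * (1 - z * x) ^ (-(1/2) : ℝ)
      = 2 * Real.arcsin (Real.sqrt z) / Real.sqrt z := by
  have hs : 0 < Real.sqrt z := Real.sqrt_pos.mpr hz0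
  have hcont : ContinuousOn
      (fun x : ℝ => 2 * Real.arcsin (Real.sqrt z * Real.sqrt x) / Real.sqrt z)
      (Set.Icc 0 1) := by
    apply Continuous.continuousOn
    exact (continuous_const.mul (Real.continuous_arcsin.comp
      (continuous_const.mul Real.continuous_sqrt))).div_const _
  have hderiv : ∀ x ∈ Set.Ioo (0:ℝ) 1, HasDerivAt
      (fun x : ℝ => 2 * Real.arcsin (Real.sqrt z * Real.sqrt x) / Real.sqrt z)
      (x ^ (-(1/2) : ℝ) * (1 - z * x) ^ (-(1/2) : ℝ)) x := by
    rintro x ⟨hx0, hx1⟩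
    have hzx : 0 < 1 - z * x := by nlinarith
    have hsx : 0 < Real.sqrt x := Real.sqrt_pos.mpr hx0
    have hsq : (Real.sqrt z * Real.sqrt x) ^ 2 = z * x := by
      rw [mul_pow, Real.sq_sqrt hz0.le, Real.sq_sqrt hx0.le]
    have hpos : 0 < Real.sqrt z * Real.sqrt x := mul_pos hs hsx
    have hlt : Real.sqrt z * Real.sqrt x < 1 := by nlinarith
    have h1 := (Real.hasDerivAt_arcsin (x := Real.sqrt z * Real.sqrt x)
      (by linarith) hlt.ne)
    have h2 := (Real.hasDerivAt_sqrt hx0.ne').const_mul (Real.sqrt z)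
    have h3 := ((h1.comp x h2).const_mul 2).div_const (Real.sqrt z)
    refine h3.congr_deriv ?_
    rw [hsq, Real.rpow_neg hx0.le, Real.rpow_neg hzx.le, ← Real.sqrt_eq_rpow,
      ← Real.sqrt_eq_rpow]
    have := Real.sqrt_pos.mpr hzx
    field_simp
  have hint : IntervalIntegrable
      (fun x : ℝ => x ^ (-(1/2) : ℝ) * (1 - z * x) ^ (-(1/2) : ℝ)) volume 0 1 := by
    rw [intervalIntegrable_iff_integrableOn_Ioc_of_le zero_le_one]
    refine intervalIntegral.integrableOn_deriv_of_nonneg hcont hderiv ?_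
    rintro x ⟨hx0, hx1⟩
    have hzx : 0 < 1 - z * x := by nlinarith
    positivity
  rw [intervalIntegral.integral_eq_sub_of_hasDerivAt_of_le zero_le_one hcont hderiv hint]
  simp
end

section
/- Let h := 1 + √3, r := √6 + √2, and ω := π²/2 (the volume of the unit ball in ℝ⁴). Define V := ω²·(1 + 8·∫₁^{r−h} u³·(r² − (u+h)²)² du) and P := 32·ω²·r·∫₁^{r−h} u³·(r² − (u+h)²) du. Then (P − 16√2·ω²/7) / V^(7/8) = 2·(2/105)^(1/8)·(−699776 + 494843√2 − 404096√3 + 285740√6)·√π / (913063 − 645632√2 + 527138√3 − 372736√6)^(7/8). -/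
open MeasureTheory Real

lemma poly_int (e c0 c1 c2 c3 c4 : ℝ) :
    ∫ u in (1:ℝ)..e, (c0 * u ^ 3 + c1 * u ^ 4 + c2 * u ^ 5 + c3 * u ^ 6 + c4 * u ^ 7)
      = c0 * ((e ^ 4 - 1) / 4) + c1 * ((e ^ 5 - 1) / 5) + c2 * ((e ^ 6 - 1) / 6)
        + c3 * ((e ^ 7 - 1) / 7) + c4 * ((e ^ 8 - 1) / 8) := by
  have key : ∀ x ∈ Set.uIcc (1:ℝ) e, HasDerivAt
      (fun u : ℝ => c0 * (u ^ 4 / 4) + c1 * (u ^ 5 / 5) + c2 * (u ^ 6 / 6)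
        + c3 * (u ^ 7 / 7) + c4 * (u ^ 8 / 8))
      (c0 * x ^ 3 + c1 * x ^ 4 + c2 * x ^ 5 + c3 * x ^ 6 + c4 * x ^ 7) x := by
    intro x _
    have h4 := ((hasDerivAt_pow 4 x).div_const 4).const_mul c0
    have h5 := ((hasDerivAt_pow 5 x).div_const 5).const_mul c1
    have h6 := ((hasDerivAt_pow 6 x).div_const 6).const_mul c2
    have h7 := ((hasDerivAt_pow 7 x).div_const 7).const_mul c3
    have h8 := ((hasDerivAt_pow 8 x).div_const 8).const_mul c4
    refine ((((h4.add h5).add h6).add h7).add h8).congr_deriv ?_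
    norm_num
  rw [intervalIntegral.integral_eq_sub_of_hasDerivAt key
    (Continuous.intervalIntegrable (by fun_prop) _ _)]
  ring

theorem simons_competitor_energy_eight (h r ω V P : ℝ)
    (hh : h = 1 + Real.sqrt 3) (hr : r = Real.sqrt 6 + Real.sqrt 2)
    (hω : ω = Real.pi ^ 2 / 2)
    (hV : V = ω ^ 2 * (1 + 8 * ∫ u in (1:ℝ)..(r - h), u ^ 3 * (r ^ 2 - (u + h) ^ 2) ^ 2))
    (hP : P = 32 * ω ^ 2 * r * ∫ u in (1:ℝ)..(r - h), u ^ 3 * (r ^ 2 - (u + h) ^ 2)) :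
    (P - 16 * Real.sqrt 2 * ω ^ 2 / 7) / V ^ ((7:ℝ)/8)
      = 2 * ((2:ℝ)/105) ^ ((1:ℝ)/8)
          * (-699776 + 494843 * Real.sqrt 2 - 404096 * Real.sqrt 3 + 285740 * Real.sqrt 6)
          * Real.sqrt Real.pi
        / (913063 - 645632 * Real.sqrt 2 + 527138 * Real.sqrt 3
            - 372736 * Real.sqrt 6) ^ ((7:ℝ)/8) := by
  have hI1 : ∫ u in (1:ℝ)..(r - h), u ^ 3 * (r ^ 2 - (u + h) ^ 2) = _ :=
    Eq.trans (by congr 1; funext u; ring)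
      (poly_int (r - h) (r ^ 2 - h ^ 2) (-2 * h) (-1) 0 0)
  have hI2 : ∫ u in (1:ℝ)..(r - h), u ^ 3 * (r ^ 2 - (u + h) ^ 2) ^ 2 = _ :=
    Eq.trans (by congr 1; funext u; ring)
      (poly_int (r - h) ((r ^ 2 - h ^ 2) ^ 2) (-4 * h * (r ^ 2 - h ^ 2))
        (4 * h ^ 2 - 2 * (r ^ 2 - h ^ 2)) (4 * h) 1)
  rw [hI1] at hP
  rw [hI2] at hV
  clear hI1 hI2
  have h6 : Real.sqrt 6 = Real.sqrt 2 * Real.sqrt 3 := by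
    rw [← Real.sqrt_mul (by norm_num)]; norm_num
  have hBpos : 0 < 913063 - 645632 * Real.sqrt 2 + 527138 * Real.sqrt 3
      - 372736 * Real.sqrt 6 := by
    have b2 : Real.sqrt 2 < 1.414213563 := by
      rw [Real.sqrt_lt' (by norm_num)]; norm_num
    have b3 : 1.732050807 < Real.sqrt 3 := by
      rw [Real.lt_sqrt (by norm_num)]; norm_num
    have b6 : Real.sqrt 6 < 2.449489743 := by
      rw [Real.sqrt_lt' (by norm_num)]; norm_num
    linarith
  rw [h6] at hr hBpos ⊢
  have ha : Real.sqrt 2 ^ 2 = 2 := Real.sq_sqrt (by norm_num)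
  have hb : Real.sqrt 3 ^ 2 = 3 := Real.sq_sqrt (by norm_num)
  generalize Real.sqrt 2 = a at *
  generalize Real.sqrt 3 = b at *
  have hh2 : h ^ 2 = 4 + 2 * b := by rw [hh]; linear_combination hb
  have hr2 : r ^ 2 = 8 + 4 * b := by
    rw [hr]; linear_combination (b + 1) ^ 2 * ha + 2 * hb
  have e1 : r - h = -1 + a - b + a * b := by rw [hr, hh]; ring
  have e2 : (r - h) ^ 2 = 12 - 8 * a + 6 * b - 4 * (a * b) := by
    rw [e1]; linear_combination (b + 1) ^ 2 * ha + (3 - 2 * a) * hb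
  have e4 : (r - h) ^ 4 = 476 - 336 * a + 272 * b - 192 * (a * b) := by
    have : (r - h) ^ 4 = ((r - h) ^ 2) ^ 2 := by ring
    rw [this, e2]
    linear_combination (4 * b + 8) ^ 2 * ha + (36 + 16 * 2 - 48 * a) * hb
  have e5 : (r - h) ^ 5 = -3116 + 2204 * a - 1804 * b + 1276 * (a * b) := by
    have : (r - h) ^ 5 = (r - h) ^ 4 * (r - h) := by ring
    rw [this, e4, e1]
    linear_combination (-336 - 192 * b) * (1 + b) * ha + (-272 - 192 * 2 + (272 + 192) * a) * hb
  have e6 : (r - h) ^ 6 = 20592 - 14560 * a + 11880 * b - 8400 * (a * b) := by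
    have : (r - h) ^ 6 = (r - h) ^ 4 * (r - h) ^ 2 := by ring
    rw [this, e4, e2]
    linear_combination (336 + 192 * b) * (8 + 4 * b) * ha
      + (272 * 6 + 192 * 4 * 2 - (272 * 4 + 192 * 6) * a) * hb
  have e7 : (r - h) ^ 7 = -135752 + 95992 * a - 78392 * b + 55432 * (a * b) := by
    have : (r - h) ^ 7 = (r - h) ^ 6 * (r - h) := by ring
    rw [this, e6, e1]
    linear_combination (-14560 - 8400 * b) * (1 + b) * ha
      + (-11880 - 8400 * 2 + (11880 + 8400) * a) * hb
  have e8 : (r - h) ^ 8 = 895504 - 633216 * a + 516992 * b - 365568 * (a * b) := by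
    have : (r - h) ^ 8 = ((r - h) ^ 4) ^ 2 := by ring
    rw [this, e4]
    linear_combination (336 + 192 * b) ^ 2 * ha
      + (272 ^ 2 + 192 ^ 2 * 2 - 2 * 272 * 192 * a) * hb
  rw [e4, e5, e6, e7, e8, hr2, hh2, hh] at hV hP
  rw [hr] at hP
  have hb3 : b ^ 3 = 3 * b := by linear_combination b * hb
  have hV' : V = (π ^ 4 * (2 / 105)) *
      (913063 - 645632 * a + 527138 * b - 372736 * (a * b)) := by
    rw [hV, hω]
    ring_nf
    simp only [hb3, hb, ha]
    ring
  have hP' : P - 16 * a * ω ^ 2 / 7 = π ^ 4 * (4 / 105) *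
      (-699776 + 494843 * a - 404096 * b + 285740 * (a * b)) := by
    rw [hP, hω]
    ring_nf
    simp only [hb3, hb, ha]
    ring
  rw [hP', hV']
  generalize (913063 - 645632 * a + 527138 * b - 372736 * (a * b)) = B at *
  generalize (-699776 + 494843 * a - 404096 * b + 285740 * (a * b)) = A at *
  have hpi := Real.pi_pos
  rw [Real.mul_rpow (by positivity) hBpos.le, Real.mul_rpow (by positivity) (by norm_num)]
  have p1 : (π ^ 4) ^ ((7:ℝ)/8) * √π = π ^ 4 := by
    rw [Real.sqrt_eq_rpow, ← Real.rpow_natCast, ← Real.rpow_mul hpi.le, ← Real.rpow_add hpi]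
    norm_num
  have p2 : ((2:ℝ)/105) ^ ((7:ℝ)/8) * ((2:ℝ)/105) ^ ((1:ℝ)/8) = 2 / 105 := by
    rw [← Real.rpow_add (by norm_num)]; norm_num
  have q1 : 0 < (π ^ 4) ^ ((7:ℝ)/8) := by positivity
  have q2 : 0 < ((2:ℝ)/105) ^ ((7:ℝ)/8) := by positivity
  have q3 : 0 < B ^ ((7:ℝ)/8) := by positivity
  rw [div_eq_div_iff (by positivity) (by positivity)]
  generalize (π ^ 4) ^ ((7:ℝ)/8) = X at *
  generalize ((2:ℝ)/105) ^ ((7:ℝ)/8) = Y at *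
  generalize ((2:ℝ)/105) ^ ((1:ℝ)/8) = Z at *
  generalize B ^ ((7:ℝ)/8) = W at *
  linear_combination (-2 * A * W * (Y * Z)) * p1 - (2 * A * W * π ^ 4) * p2
end

section
/- Let h := 1 + √3, r := √6 + √2, ω := π²/2, ω₇ := 16π³/105, V := ω²·(1 + 8·∫₁^{r−h} u³·(r² − (u+h)²)² du), and P := 32·ω²·r·∫₁^{r−h} u³·(r² − (u+h)²) du. Then (P − 16√2·ω²/7) / V^(7/8) < (14·ω₇·∫_{1/2}^{1}(1 − t²)^(5/2) dt − ω₇·(√3/2)⁷) / (2·ω₇·∫_{1/2}^{1}(1 − t²)^(7/2) dt)^(7/8). -/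
open MeasureTheory Real

lemma aux_sub (p : ℝ) (n : ℕ) (hp : 0 ≤ p) (hn : 2 * p = n) :
    ∫ t in (1/2:ℝ)..1, (1 - t ^ 2) ^ p = ∫ x in (0:ℝ)..(Real.pi/3), Real.sin x ^ (n + 1) := by
  have h1 := intervalIntegral.integral_comp_mul_deriv (a := Real.pi/3) (b := 0)
    (f := Real.cos) (f' := fun x => - Real.sin x) (g := fun t : ℝ => (1 - t ^ 2) ^ p)
    (fun x _ => Real.hasDerivAt_cos x) (by fun_prop)
    (Continuous.rpow_const (by fun_prop) (fun _ => Or.inr hp))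
  rw [Real.cos_pi_div_three, Real.cos_zero] at h1
  rw [← h1, intervalIntegral.integral_symm, ← intervalIntegral.integral_neg]
  apply intervalIntegral.integral_congr
  intro x hx
  rw [Set.uIcc_of_le (by positivity)] at hx
  have hs : 0 ≤ Real.sin x :=
    Real.sin_nonneg_of_nonneg_of_le_pi hx.1 (by linarith [hx.2, Real.pi_pos])
  have e : 1 - Real.cos x ^ 2 = Real.sin x ^ (2:ℝ) := by
    rw [Real.rpow_two]; linarith [Real.sin_sq_add_cos_sq x]
  simp only [Function.comp]
  rw [e, ← Real.rpow_mul hs, hn, Real.rpow_natCast]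
  ring

lemma aux_sin_step (n : ℕ) : ∫ x in (0:ℝ)..(Real.pi/3), Real.sin x ^ (n + 2)
    = - ((Real.sqrt 3 / 2) ^ (n + 1) / 2) / (n + 2)
      + (n + 1) / (n + 2) * ∫ x in (0:ℝ)..(Real.pi/3), Real.sin x ^ n := by
  rw [integral_sin_pow]
  simp
  ring

lemma aux_J6 : ∫ x in (0:ℝ)..(Real.pi/3), Real.sin x ^ 6
    = 5 * Real.pi / 48 - 9 * Real.sqrt 3 / 64 := by
  have h3 : Real.sqrt 3 ^ 2 = 3 := Real.sq_sqrt (by norm_num)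
  have h33 : Real.sqrt 3 ^ 3 = 3 * Real.sqrt 3 := by rw [pow_succ, h3]
  have h35 : Real.sqrt 3 ^ 5 = 9 * Real.sqrt 3 := by
    rw [show Real.sqrt 3 ^ 5 = (Real.sqrt 3 ^ 2) ^ 2 * Real.sqrt 3 by ring, h3]; ring
  have a := aux_sin_step 4
  have b := aux_sin_step 2
  norm_num [div_pow, h33, h35] at a b
  rw [a, b]
  ring

lemma aux_J8 : ∫ x in (0:ℝ)..(Real.pi/3), Real.sin x ^ 8
    = 35 * Real.pi / 384 - 279 * Real.sqrt 3 / 2048 := by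
  have h3 : Real.sqrt 3 ^ 2 = 3 := Real.sq_sqrt (by norm_num)
  have h37 : Real.sqrt 3 ^ 7 = 27 * Real.sqrt 3 := by
    rw [show Real.sqrt 3 ^ 7 = (Real.sqrt 3 ^ 2) ^ 3 * Real.sqrt 3 by ring, h3]; ring
  have a := aux_sin_step 6
  norm_num [div_pow, h37] at a
  rw [a, aux_J6]
  ring

lemma aux_B (k d h r a : ℝ) (hk : k = 2 * (1 + h)) (hd : a = 1 + d) (hq : r ^ 2 = 1 + (1 + h) ^ 2) :
    ∫ u in (1:ℝ)..a, u ^ 3 * (r ^ 2 - (u + h) ^ 2)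
      = d + (3-k)*d^2/2 + (2-3*k)*d^3/3 + (-2-3*k)*d^4/4 - (k+3)*d^5/5 - d^6/6 := by
  have key : ∀ u : ℝ, HasDerivAt (fun u : ℝ => (u-1) + (3-k)/2*(u-1)^2 + (2-3*k)/3*(u-1)^3
      + (-2-3*k)/4*(u-1)^4 - (k+3)/5*(u-1)^5 - 1/6*(u-1)^6)
      (u ^ 3 * (r ^ 2 - (u + h) ^ 2)) u := by
    intro u
    have h0 : HasDerivAt (fun u : ℝ => u - 1) 1 u := (hasDerivAt_id u).sub_const 1
    refine HasDerivAt.congr_deriv (((((h0.add ((h0.pow 2).const_mul ((3-k)/2))).add ((h0.pow 3).const_mul ((2-3*k)/3))).add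
      ((h0.pow 4).const_mul ((-2-3*k)/4))).sub ((h0.pow 5).const_mul ((k+3)/5))).sub
      ((h0.pow 6).const_mul (1/6))) ?_
    rw [hq, hk]; push_cast; ring
  rw [intervalIntegral.integral_eq_sub_of_hasDerivAt (fun u _ => key u)
    (Continuous.intervalIntegrable (by fun_prop) _ _), hd]
  ring

lemma aux_A (k d h r a : ℝ) (hk : k = 2 * (1 + h)) (hd : a = 1 + d) (hq : r ^ 2 = 1 + (1 + h) ^ 2) :
    ∫ u in (1:ℝ)..a, u ^ 3 * (r ^ 2 - (u + h) ^ 2) ^ 2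
      = d + (3-2*k)*d^2/2 + (1-6*k+k^2)*d^3/3 + (3*k^2-4*k-5)*d^4/4 + (3*k^2+4*k-5)*d^5/5
        + (k^2+6*k+1)*d^6/6 + (2*k+3)*d^7/7 + d^8/8 := by
  have key : ∀ u : ℝ, HasDerivAt (fun u : ℝ => (u-1) + (3-2*k)/2*(u-1)^2 + (1-6*k+k^2)/3*(u-1)^3
      + (3*k^2-4*k-5)/4*(u-1)^4 + (3*k^2+4*k-5)/5*(u-1)^5 + (k^2+6*k+1)/6*(u-1)^6
      + (2*k+3)/7*(u-1)^7 + 1/8*(u-1)^8)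
      (u ^ 3 * (r ^ 2 - (u + h) ^ 2) ^ 2) u := by
    intro u
    have h0 : HasDerivAt (fun u : ℝ => u - 1) 1 u := (hasDerivAt_id u).sub_const 1
    refine HasDerivAt.congr_deriv (((((((h0.add ((h0.pow 2).const_mul ((3-2*k)/2))).add
      ((h0.pow 3).const_mul ((1-6*k+k^2)/3))).add
      ((h0.pow 4).const_mul ((3*k^2-4*k-5)/4))).add ((h0.pow 5).const_mul ((3*k^2+4*k-5)/5))).add
      ((h0.pow 6).const_mul ((k^2+6*k+1)/6))).add ((h0.pow 7).const_mul ((2*k+3)/7))).add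
      ((h0.pow 8).const_mul (1/8))) ?_
    rw [hq, hk]; push_cast; ring
  rw [intervalIntegral.integral_eq_sub_of_hasDerivAt (fun u _ => key u)
    (Continuous.intervalIntegrable (by fun_prop) _ _), hd]
  ring

lemma aux_pow (d k : ℝ) (h1 : 0.13165 ≤ d) (h2 : d ≤ 0.13166) (k1 : 7.4641 ≤ k) (k2 : k ≤ 7.46411)
    (i j : ℕ) : 7.4641 ^ j * 0.13165 ^ i ≤ k ^ j * d ^ i ∧ k ^ j * d ^ i ≤ 7.46411 ^ j * 0.13166 ^ i := by
  constructor <;> gcongr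

lemma aux_Bb (d k : ℝ) (h1 : 0.13165 ≤ d) (h2 : d ≤ 0.13166) (k1 : 7.4641 ≤ k) (k2 : k ≤ 7.46411) :
    d + (3-k)*d^2/2 + (2-3*k)*d^3/3 + (-2-3*k)*d^4/4 - (k+3)*d^5/5 - d^6/6 ≤ 0.0756 := by
  have H := aux_pow d k h1 h2 k1 k2
  have e2 := H 2 0
  have e3 := H 3 0
  have e4 := H 4 0
  have e5 := H 5 0
  have e6 := H 6 0
  have f2 := H 2 1
  have f3 := H 3 1
  have f4 := H 4 1
  have f5 := H 5 1
  norm_num at e2 e3 e4 e5 e6 f2 f3 f4 f5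
  linarith [e2.2, e3.2, e4.1, e5.1, e6.1, f2.1, f3.1, f4.1, f5.1]

lemma aux_Ab (d k : ℝ) (h1 : 0.13165 ≤ d) (h2 : d ≤ 0.13166) (k1 : 7.4641 ≤ k) (k2 : k ≤ 7.46411) :
    0.0488 ≤ d + (3-2*k)*d^2/2 + (1-6*k+k^2)*d^3/3 + (3*k^2-4*k-5)*d^4/4 + (3*k^2+4*k-5)*d^5/5
        + (k^2+6*k+1)*d^6/6 + (2*k+3)*d^7/7 + d^8/8 := by
  have H := aux_pow d k h1 h2 k1 k2
  have e2 := H 2 0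
  have e3 := H 3 0
  have e4 := H 4 0
  have e5 := H 5 0
  have e6 := H 6 0
  have e7 := H 7 0
  have e8 := H 8 0
  have f2 := H 2 1
  have f3 := H 3 1
  have f4 := H 4 1
  have f5 := H 5 1
  have f6 := H 6 1
  have f7 := H 7 1
  have g3 := H 3 2
  have g4 := H 4 2
  have g5 := H 5 2
  have g6 := H 6 2
  norm_num at e2 e3 e4 e5 e6 e7 e8 f2 f3 f4 f5 f6 f7 g3 g4 g5 g6
  linarith [e2.1, e3.1, e4.2, e5.2, e6.1, e7.1, e8.1, f2.2, f3.2, f4.2, f5.1, f6.1, f7.1,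
    g3.1, g4.1, g5.1, g6.1]

lemma aux_final (X V N W : ℝ) (hX : X ≤ 149.2) (hV : 33.8 ≤ V) (hN : 3.8 ≤ N) (hW0 : 0 < W)
    (hW : W ≤ 0.477) : X / V ^ ((7:ℝ)/8) < N / W ^ ((7:ℝ)/8) := by
  have hV0 : 0 < V := by linarith
  have pw : ∀ x : ℝ, 0 < x → (x ^ ((7:ℝ)/8)) ^ 8 = x ^ 7 := by
    intro x hx
    rw [← Real.rpow_natCast, ← Real.rpow_mul hx.le, ← Real.rpow_natCast]
    norm_num
  have c1 : (33.8:ℝ) ^ ((7:ℝ)/8) ≤ V ^ ((7:ℝ)/8) :=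
    Real.rpow_le_rpow (by norm_num) hV (by norm_num)
  have c2 : W ^ ((7:ℝ)/8) ≤ (0.477:ℝ) ^ ((7:ℝ)/8) :=
    Real.rpow_le_rpow hW0.le hW (by norm_num)
  have p1 : 0 < (33.8:ℝ) ^ ((7:ℝ)/8) := by positivity
  have p2 : 0 < W ^ ((7:ℝ)/8) := by positivity
  have mid : 149.2 * (0.477:ℝ) ^ ((7:ℝ)/8) < 3.8 * (33.8:ℝ) ^ ((7:ℝ)/8) := by
    apply lt_of_pow_lt_pow_left₀ 8 (by positivity)
    rw [mul_pow, mul_pow, pw _ (by norm_num), pw _ (by norm_num)]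
    norm_num
  rw [div_lt_div_iff₀ (by positivity) p2]
  calc X * W ^ ((7:ℝ)/8) ≤ 149.2 * W ^ ((7:ℝ)/8) := by gcongr
    _ ≤ 149.2 * (0.477:ℝ) ^ ((7:ℝ)/8) := by gcongr
    _ < 3.8 * (33.8:ℝ) ^ ((7:ℝ)/8) := mid
    _ ≤ N * V ^ ((7:ℝ)/8) := by gcongr

theorem simons_competitor_lt_lens_eight (h r ω ω₇ V P : ℝ)
    (hh : h = 1 + Real.sqrt 3) (hr : r = Real.sqrt 6 + Real.sqrt 2)
    (hω : ω = Real.pi ^ 2 / 2) (hω₇ : ω₇ = 16 * Real.pi ^ 3 / 105)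
    (hV : V = ω ^ 2 * (1 + 8 * ∫ u in (1:ℝ)..(r - h), u ^ 3 * (r ^ 2 - (u + h) ^ 2) ^ 2))
    (hP : P = 32 * ω ^ 2 * r * ∫ u in (1:ℝ)..(r - h), u ^ 3 * (r ^ 2 - (u + h) ^ 2)) :
    (P - 16 * Real.sqrt 2 * ω ^ 2 / 7) / V ^ ((7:ℝ)/8)
      < (14 * ω₇ * (∫ t in (1/2:ℝ)..1, (1 - t ^ 2) ^ ((5:ℝ)/2))
            - ω₇ * (Real.sqrt 3 / 2) ^ 7)
          / (2 * ω₇ * (∫ t in (1/2:ℝ)..1, (1 - t ^ 2) ^ ((7:ℝ)/2))) ^ ((7:ℝ)/8) := by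
  have s3 : Real.sqrt 3 ^ 2 = 3 := Real.sq_sqrt (by norm_num)
  have s2 : Real.sqrt 2 ^ 2 = 2 := Real.sq_sqrt (by norm_num)
  have s6 : Real.sqrt 6 = Real.sqrt 2 * Real.sqrt 3 := by
    rw [← Real.sqrt_mul (by norm_num)]; norm_num
  have a3 : 1.7320508 ≤ Real.sqrt 3 := Real.le_sqrt_of_sq_le (by norm_num)
  have b3 : Real.sqrt 3 ≤ 1.7320509 := Real.sqrt_le_iff.2 (by norm_num)
  have a2 : 1.4142135 ≤ Real.sqrt 2 := Real.le_sqrt_of_sq_le (by norm_num)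
  have b2 : Real.sqrt 2 ≤ 1.4142136 := Real.sqrt_le_iff.2 (by norm_num)
  have a6 : 2.4494897 ≤ Real.sqrt 6 := Real.le_sqrt_of_sq_le (by norm_num)
  have b6 : Real.sqrt 6 ≤ 2.4494898 := Real.sqrt_le_iff.2 (by norm_num)
  have hq : r ^ 2 = 1 + (1 + h) ^ 2 := by
    rw [hr, hh, s6]
    linear_combination (Real.sqrt 3 + 1) ^ 2 * s2 + s3
  have d1 : 0.13165 ≤ r - h - 1 := by rw [hr, hh]; linarith
  have d2 : r - h - 1 ≤ 0.13166 := by rw [hr, hh]; linarith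
  have k1 : 7.4641 ≤ 2 * (1 + h) := by rw [hh]; linarith
  have k2 : 2 * (1 + h) ≤ 7.46411 := by rw [hh]; linarith
  have hB := aux_Bb _ _ d1 d2 k1 k2
  rw [← aux_B (2 * (1 + h)) (r - h - 1) h r (r - h) rfl (by ring) hq] at hB
  have hA := aux_Ab _ _ d1 d2 k1 k2
  rw [← aux_A (2 * (1 + h)) (r - h - 1) h r (r - h) rfl (by ring) hq] at hA
  have J6 : ∫ t in (1/2:ℝ)..1, (1 - t ^ 2) ^ ((5:ℝ)/2) = 5 * Real.pi / 48 - 9 * Real.sqrt 3 / 64 := by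
    rw [aux_sub _ 5 (by norm_num) (by norm_num), aux_J6]
  have J8 : ∫ t in (1/2:ℝ)..1, (1 - t ^ 2) ^ ((7:ℝ)/2)
      = 35 * Real.pi / 384 - 279 * Real.sqrt 3 / 2048 := by
    rw [aux_sub _ 7 (by norm_num) (by norm_num), aux_J8]
  have s37 : (Real.sqrt 3 / 2) ^ 7 = 27 * Real.sqrt 3 / 128 := by
    rw [show (Real.sqrt 3 / 2) ^ 7 = (Real.sqrt 3 ^ 2) ^ 3 * Real.sqrt 3 / 128 by ring, s3]; ring
  have p1 := Real.pi_gt_d6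
  have p2 := Real.pi_lt_d6
  have w1 : 24.352 ≤ ω ^ 2 := by
    rw [hω, show (Real.pi ^ 2 / 2) ^ 2 = Real.pi ^ 4 / 4 by ring]
    have : (3.141592:ℝ) ^ 4 ≤ Real.pi ^ 4 := by gcongr
    norm_num at this ⊢; linarith
  have w2 : ω ^ 2 ≤ 24.353 := by
    rw [hω, show (Real.pi ^ 2 / 2) ^ 2 = Real.pi ^ 4 / 4 by ring]
    have : Real.pi ^ 4 ≤ (3.141593:ℝ) ^ 4 := by gcongr
    norm_num at this ⊢; linarith
  have v1 : 4.7247 ≤ ω₇ := by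
    rw [hω₇]
    have : (3.141592:ℝ) ^ 3 ≤ Real.pi ^ 3 := by gcongr
    norm_num at this ⊢; linarith
  have v2 : ω₇ ≤ 4.7249 := by
    rw [hω₇]
    have : Real.pi ^ 3 ≤ (3.141593:ℝ) ^ 3 := by gcongr
    norm_num at this ⊢; linarith
  rw [J6, J8, s37]
  have r2 : r ≤ 3.8637034 := by rw [hr]; linarith
  have r1 : 0 ≤ r := by rw [hr]; positivity
  apply aux_final
  · rw [hP]
    generalize (∫ u in (1:ℝ)..(r - h), u ^ 3 * (r ^ 2 - (u + h) ^ 2)) = B at hB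
    have : r * B ≤ 3.8637034 * 0.0756 :=
      (mul_le_mul_of_nonneg_left hB r1).trans (by gcongr)
    have e : 32 * (r * B) - 16 * Real.sqrt 2 / 7 ≤ 6.1146 := by linarith
    calc 32 * ω ^ 2 * r * B - 16 * Real.sqrt 2 * ω ^ 2 / 7
        = ω ^ 2 * (32 * (r * B) - 16 * Real.sqrt 2 / 7) := by ring
      _ ≤ ω ^ 2 * 6.1146 := by gcongr
      _ ≤ 149.2 := by linarith
  · rw [hV]
    generalize (∫ u in (1:ℝ)..(r - h), u ^ 3 * (r ^ 2 - (u + h) ^ 2) ^ 2) = A at hA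
    calc (33.8:ℝ) ≤ 24.352 * (1 + 8 * 0.0488) := by norm_num
      _ ≤ _ := by gcongr
  · calc (3.8:ℝ) ≤ 4.7247 * 0.8055 := by norm_num
      _ ≤ ω₇ * (14 * (5 * Real.pi / 48 - 9 * Real.sqrt 3 / 64) - 27 * Real.sqrt 3 / 128) := by
        gcongr; linarith
      _ = _ := by ring
  · have : 0 < 35 * Real.pi / 384 - 279 * Real.sqrt 3 / 2048 := by linarith
    positivity
  · have : 35 * Real.pi / 384 - 279 * Real.sqrt 3 / 2048 ≤ 0.0504 := by linarith
    calc _ ≤ 2 * ω₇ * 0.0504 := by gcongr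
      _ ≤ _ := by linarith
end

section
/- For every even integer n with 4 ≤ n ≤ 2700, setting k := n/2 − 1, the inequality M(k,k) < Λ_plane(n) holds, where M(k,l) and Λ_plane(n) are the explicit quantities defined in the context. -/
open MeasureTheory Real

/-- The renormalized lens energy `Λ_plane(n)`. -/
noncomputable def lambdaPlane (n : ℕ) : ℝ :=
  let ω : ℝ := Real.pi ^ (((n:ℝ) - 1)/2) / Real.Gamma (((n:ℝ) + 1)/2)
  (2 * ((n:ℝ) - 1) * ω * (∫ t in (1/2:ℝ)..1, (1 - t ^ 2) ^ (((n:ℝ) - 3)/2))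
      - ω * (Real.sqrt 3 / 2) ^ ((n:ℝ) - 1))
    / (2 * ω * (∫ t in (1/2:ℝ)..1, (1 - t ^ 2) ^ (((n:ℝ) - 1)/2))) ^ (((n:ℝ) - 1)/(n:ℝ))

/-- The energy `M(k,l)` of the explicit `SO(k+1) × SO(l+1)`-invariant competitor adapted
to the Lawson cone `C_{k,l}` in dimension `n = k + l + 2`. -/
noncomputable def lawsonCompetitorEnergy (k l : ℕ) : ℝ :=
  let n : ℝ := (k:ℝ) + (l:ℝ) + 2
  let lam : ℝ := Real.sqrt ((k:ℝ) / (l:ℝ))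
  let θ : ℝ := Real.arctan lam
  let h : ℝ := lam * Real.tan (2 * Real.pi / 3 - θ) - 1
  let r : ℝ := lam / Real.cos (2 * Real.pi / 3 - θ)
  let d : ℝ := Real.tan (Real.pi / 6 + θ) - lam
  let ρ : ℝ := 1 / Real.cos (Real.pi / 6 + θ)
  let ωk : ℝ := Real.pi ^ (((k:ℝ) + 1)/2) / Real.Gamma (((k:ℝ) + 1)/2 + 1)
  let ωl : ℝ := Real.pi ^ (((l:ℝ) + 1)/2) / Real.Gamma (((l:ℝ) + 1)/2 + 1)
  let V : ℝ := ωk * ωl *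
    (lam ^ (k + 1)
      + ((k:ℝ) + 1) * (∫ u in lam..(ρ - d), u ^ k * (ρ ^ 2 - (u + d) ^ 2) ^ (((l:ℝ) + 1)/2))
      + ((l:ℝ) + 1) * (∫ v in (1:ℝ)..(r - h), v ^ l * (r ^ 2 - (v + h) ^ 2) ^ (((k:ℝ) + 1)/2)))
  let P : ℝ := ωk * ωl * ((k:ℝ) + 1) * ((l:ℝ) + 1) *
    (ρ * (∫ u in lam..(ρ - d), u ^ k * (ρ ^ 2 - (u + d) ^ 2) ^ (((l:ℝ) - 1)/2))
      + r * (∫ v in (1:ℝ)..(r - h), v ^ l * (r ^ 2 - (v + h) ^ 2) ^ (((k:ℝ) - 1)/2)))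
  (P - ωk * ωl * ((k:ℝ) + 1) * ((l:ℝ) + 1) * lam ^ k * Real.sqrt (1 + lam ^ 2)
      / ((k:ℝ) + (l:ℝ) + 1))
    / V ^ ((n - 1)/n)

open intervalIntegral

lemma aux_s3 : (1.73205:ℝ) ≤ √3 ∧ √3 ≤ 1.73206 ∧ √3^2 = 3 := by
  refine ⟨Real.le_sqrt_of_sq_le (by norm_num), ?_, Real.sq_sqrt (by norm_num)⟩
  rw [Real.sqrt_le_left (by norm_num)]; norm_num

lemma aux_s2 : (1.41421:ℝ) ≤ √2 ∧ √2 ≤ 1.41422 ∧ √2^2 = 2 := by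
  refine ⟨Real.le_sqrt_of_sq_le (by norm_num), ?_, Real.sq_sqrt (by norm_num)⟩
  rw [Real.sqrt_le_left (by norm_num)]; norm_num

lemma aux_y (x : ℝ) (hx : 0 ≤ x) (hx1 : x ≤ 0.1317) :
    5.4641*x+14.9282*x^2+9.4641*x^3 ≤ (2+2*√3)*x+(8+4*√3)*x^2+(6+2*√3)*x^3+x^4 ∧
    (2+2*√3)*x+(8+4*√3)*x^2+(6+2*√3)*x^3+x^4 ≤ 5.46412*x+14.92824*x^2+9.59582*x^3 := by
  obtain ⟨h1, h2, -⟩ := aux_s3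
  have e2 : 0 ≤ x^2 := by positivity
  have e3 : 0 ≤ x^3 := by positivity
  have e4 : 0 ≤ x^4 := by positivity
  have e5 : x^4 ≤ 0.1317 * x^3 := by
    have : x^4 = x * x^3 := by ring
    rw [this]; gcongr
  constructor
  · nlinarith [mul_nonneg hx (sub_nonneg.2 h1), mul_nonneg e2 (sub_nonneg.2 h1), mul_nonneg e3 (sub_nonneg.2 h1)]
  · nlinarith [mul_nonneg hx (sub_nonneg.2 h2), mul_nonneg e2 (sub_nonneg.2 h2), mul_nonneg e3 (sub_nonneg.2 h2)]

lemma aux_poly1 (x y : ℝ) (hx : 0 ≤ x) (hx1 : x ≤ 0.1317)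
    (hy : y = (2+2*√3)*x+(8+4*√3)*x^2+(6+2*√3)*x^3+x^4) :
    1 ≤ (1+(1+2*√3)*x+(√3-1)*x^2) * (1 - 37/50*y + 1/2*y^2) := by
  obtain ⟨h1, h2, -⟩ := aux_s3
  obtain ⟨a1, a2⟩ := aux_y x hx hx1
  rw [← hy] at a1 a2
  set yl := 5.4641*x+14.9282*x^2+9.4641*x^3 with hyl
  set yu := 5.46412*x+14.92824*x^2+9.59582*x^3 with hyu
  have hl0 : 0 ≤ yl := by positivity
  have hQ : 1 - 37/50*yu + 1/2*yl^2 ≤ 1 - 37/50*y + 1/2*y^2 := by nlinarith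
  have hQ0 : 0 ≤ 1 - 37/50*y + 1/2*y^2 := by nlinarith [sq_nonneg (y - 37/50)]
  have hq : 1 + 4.4641*x + 0.73205*x^2 ≤ 1+(1+2*√3)*x+(√3-1)*x^2 := by nlinarith [sq_nonneg x]
  calc 1 ≤ (1 + 4.4641*x + 0.73205*x^2) * (1 - 37/50*yu + 1/2*yl^2) := by
        have : 0 ≤ x * (0.4206 - 13.44*x + 88*x^2+480*x^3) := by
          apply mul_nonneg hx
          nlinarith [mul_nonneg hx (sq_nonneg (x-0.05)), sq_nonneg (x-0.05)]
        rw [hyl, hyu]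
        have e4 : 0 ≤ x^4 := by positivity
        have e5 : 0 ≤ x^5 := by positivity
        have e6 : 0 ≤ x^6 := by positivity
        have e7 : 0 ≤ x^7 := by positivity
        have e8 : 0 ≤ x^8 := by positivity
        have e3 : 0 ≤ x^3 := by positivity
        have e2 : 0 ≤ x^2 := by positivity
        ring_nf at this ⊢
        linarith
    _ ≤ (1 + 4.4641*x + 0.73205*x^2) * (1 - 37/50*y + 1/2*y^2) := by gcongr
    _ ≤ _ := by gcongr

lemma aux_poly2 (x y : ℝ) (hx : 0 ≤ x) (hx1 : x ≤ 0.1317)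
    (hy : y = (2+2*√3)*x+(8+4*√3)*x^2+(6+2*√3)*x^3+x^4) :
    (1+x)^2*(1+(1+2*√3)*x+(√3-1)*x^2) * (1 - 6/5*y + 3/5*y^2) ≤ 1 := by
  obtain ⟨h1, h2, -⟩ := aux_s3
  obtain ⟨a1, a2⟩ := aux_y x hx hx1
  rw [← hy] at a1 a2
  set yl := 5.4641*x+14.9282*x^2+9.4641*x^3 with hyl
  set yu := 5.46412*x+14.92824*x^2+9.59582*x^3 with hyu
  have hl0 : 0 ≤ yl := by positivity
  have hQ : 1 - 6/5*y + 3/5*y^2 ≤ 1 - 6/5*yl + 3/5*yu^2 := by nlinarith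
  have hQ0 : 0 ≤ 1 - 6/5*y + 3/5*y^2 := by nlinarith [sq_nonneg (y - 1)]
  have hq : 1+(1+2*√3)*x+(√3-1)*x^2 ≤ 1 + 4.46412*x+0.73206*x^2 := by nlinarith [sq_nonneg x]
  have hq0 : 0 ≤ 1+(1+2*√3)*x+(√3-1)*x^2 := by nlinarith [sq_nonneg x]
  calc _ ≤ (1+x)^2*(1 + 4.46412*x+0.73206*x^2) * (1 - 6/5*y + 3/5*y^2) := by gcongr
    _ ≤ (1+x)^2*(1 + 4.46412*x+0.73206*x^2) * (1 - 6/5*yl + 3/5*yu^2) := by gcongr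
    _ ≤ 1 := by
        have st : ∀ j : ℕ, x^(j+2) ≤ 0.1317^j * x^2 := fun j => by
          rw [pow_add]; gcongr
        have e2 : x^2 ≤ 0.1317*x := by nlinarith
        have t1 := st 1
        have t2 := st 2
        have t3 := st 3
        have t4 := st 4
        have t5 := st 5
        have t6 := st 6
        have t7 := st 7
        have t8 := st 8
        norm_num at t1 t2 t3 t4 t5 t6 t7 t8
        have e0 : 0 ≤ x^2 := by positivity
        rw [hyl, hyu]
        ring_nf
        linarith
lemma aux_ftc (w w' : ℝ → ℝ) (a b : ℝ) (hd : ∀ x, HasDerivAt w (w' x) x) (hc : Continuous w')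
    (p : ℝ) (hp : 0 ≤ p) (α β γ : ℝ) :
    ∫ x in a..b, w' x * (α * w x ^ p + β * w x ^ (p+1) + γ * w x ^ (p+2)) =
      (α * w b ^ (p+1)/(p+1) + β * w b ^ (p+2)/(p+2) + γ * w b ^ (p+3)/(p+3)) -
      (α * w a ^ (p+1)/(p+1) + β * w a ^ (p+2)/(p+2) + γ * w a ^ (p+3)/(p+3)) := by
  have hw : Continuous w := continuous_iff_continuousAt.2 fun x => (hd x).continuousAt
  have c0 : ∀ q : ℝ, 0 ≤ q → Continuous fun x => w x ^ q := fun q hq =>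
    hw.rpow_const fun x => Or.inr hq
  have c1 := c0 p hp
  have c2 := c0 (p+1) (by linarith)
  have c3 := c0 (p+2) (by linarith)
  refine integral_eq_sub_of_hasDerivAt
    (f := fun x => α * w x ^ (p+1)/(p+1) + β * w x ^ (p+2)/(p+2) + γ * w x ^ (p+3)/(p+3))
    (fun x _ => ?_) ?_
  · have d : ∀ q : ℝ, 0 ≤ q → ∀ A : ℝ, HasDerivAt (fun x => A * w x ^ (q+1) / (q+1)) (w' x * (A * w x ^ q)) x := by
      intro q hq A
      have := (((hd x).rpow_const (p := q+1) (Or.inr (by linarith))).const_mul A).div_const (q+1)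
      refine this.congr_deriv ?_
      have : q + 1 ≠ 0 := by positivity
      rw [show q + 1 - 1 = q by ring]
      field_simp
    have d1 := d p hp α
    have d2 := d (p+1) (by linarith) β
    have d3 := d (p+2) (by linarith) γ
    rw [show p+1+1 = p+2 by ring] at d2
    rw [show p+2+1 = p+3 by ring] at d3
    refine ((d1.add d2).add d3).congr_deriv ?_
    ring
  · apply Continuous.intervalIntegrable
    fun_prop

/-- profile function -/
noncomputable def wP (u : ℝ) : ℝ := u^2*((√2*(1+√3))^2-(u+(1+√3))^2)
noncomputable def wP' (u : ℝ) : ℝ := 2*u*((√2*(1+√3))^2-(u+(1+√3))^2) - 2*u^2*(u+(1+√3))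

lemma wP_deriv (x : ℝ) : HasDerivAt wP (wP' x) x := by
  have h1 : HasDerivAt (fun u : ℝ => u^2) (2*x) x := by simpa using hasDerivAt_pow 2 x
  have h2 : HasDerivAt (fun u : ℝ => (u+(1+√3))^2) (2*(x+(1+√3))) x := by
    refine (((hasDerivAt_id x).add_const (1+√3)).pow 2).congr_deriv ?_
    simp
  have := h1.mul (h2.const_sub ((√2*(1+√3))^2))
  refine this.congr_deriv ?_
  simp only [wP']; ring

lemma wP'_cont : Continuous wP' := by unfold wP'; fun_prop

lemma r_sq : (√2*(1+√3))^2 = 8+4*√3 := by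
  obtain ⟨-, -, h3⟩ := aux_s3
  obtain ⟨-, -, h2⟩ := aux_s2
  rw [mul_pow, h2]; linear_combination 2*h3

lemma wP_one : wP 1 = 1 := by
  obtain ⟨-, -, h3⟩ := aux_s3
  rw [wP, r_sq]; linear_combination -h3

lemma wP_end : wP (√2*(1+√3) - (1+√3)) = 0 := by
  rw [wP]; ring

lemma wP_eq (x : ℝ) : wP (1+x) = 1 - ((2+2*√3)*x+(8+4*√3)*x^2+(6+2*√3)*x^3+x^4) := by
  obtain ⟨-, -, h3⟩ := aux_s3
  rw [wP, r_sq]; linear_combination -(1+x)^2*h3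

lemma wP'_eq (x : ℝ) : wP' (1+x) = -2*(1+√3)*(1+x)*(1+(1+2*√3)*x+(√3-1)*x^2) := by
  obtain ⟨-, -, h3⟩ := aux_s3
  rw [wP', r_sq]; linear_combination (-2*(1+x) + 2 * (1+x) * (2*x+x^2))*h3

lemma end_bd : 1 ≤ √2*(1+√3) - (1+√3) ∧ √2*(1+√3) - (1+√3) ≤ 1.1317 := by
  obtain ⟨h1, h2, h3⟩ := aux_s3
  obtain ⟨g1, g2, g3⟩ := aux_s2
  constructor <;> nlinarith

lemma wP_fac (u : ℝ) (hu : 0 ≤ u) (hu' : u ≤ √2*(1+√3) - (1+√3)) :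
    0 ≤ (√2*(1+√3))^2-(u+(1+√3))^2 := by
  have : 0 ≤ √3 := by positivity
  nlinarith [sq_nonneg (u + (1+√3))]

lemma rp2 (w p : ℝ) (hw : 0 ≤ w) (hp : 0 ≤ p) (α β γ : ℝ) :
    α * w^p + β * w^(p+1) + γ * w^(p+2) = w^p * (α + β * w + γ * w^2) := by
  have e1 : w^(p+1) = w^p*w := by
    rw [Real.rpow_add_of_nonneg hw hp (by norm_num), Real.rpow_one]
  have e2 : w^(p+2) = w^p*w^2 := by
    rw [Real.rpow_add_of_nonneg hw hp (by norm_num)]; norm_num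
  rw [e1, e2]; ring

lemma IP_le (k : ℕ) (hk : 1 ≤ k) :
    ∫ u in (1:ℝ)..(√2*(1+√3) - (1+√3)), u ^ k * ((√2*(1+√3)) ^ 2 - (u + (1+√3)) ^ 2) ^ (((k:ℝ) - 1)/2)
    ≤ 1/(2*(1+√3)) * (19/25/(((k:ℝ) - 1)/2+1) - 13/50/(((k:ℝ) - 1)/2+2) + 1/2/(((k:ℝ) - 1)/2+3)) := by
  have hk' : (1:ℝ) ≤ k := by exact_mod_cast hk
  set p := ((k:ℝ) - 1)/2 with hp
  have hp0 : 0 ≤ p := by rw [hp]; linarith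
  have key := aux_ftc wP wP' 1 (√2*(1+√3) - (1+√3)) wP_deriv wP'_cont p hp0 (19/25) (-13/50) (1/2)
  rw [wP_one, wP_end, Real.zero_rpow (by positivity), Real.zero_rpow (by positivity),
    Real.zero_rpow (by positivity), Real.one_rpow, Real.one_rpow, Real.one_rpow] at key
  have hR : 1/(2*(1+√3)) * (19/25/(p+1) - 13/50/(p+2) + 1/2/(p+3)) =
      ∫ x in (1:ℝ)..(√2*(1+√3) - (1+√3)), (-1/(2*(1+√3))) *
        (wP' x * (19/25 * wP x ^ p + (-13/50) * wP x ^ (p+1) + 1/2 * wP x ^ (p+2))) := by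
    rw [intervalIntegral.integral_const_mul, key]; ring
  rw [hR]
  have hw : Continuous wP := continuous_iff_continuousAt.2 fun x => (wP_deriv x).continuousAt
  have c0 : ∀ q : ℝ, 0 ≤ q → Continuous fun x => wP x ^ q := fun q hq =>
    hw.rpow_const fun x => Or.inr hq
  have c1 := c0 p hp0
  have c2 := c0 (p+1) (by linarith)
  have c3 := c0 (p+2) (by linarith)
  have c4 := wP'_cont
  apply integral_mono_on end_bd.1
  · apply Continuous.intervalIntegrable
    apply Continuous.mul (by fun_prop)
    exact Continuous.rpow_const (by fun_prop) fun x => Or.inr hp0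
  · apply Continuous.intervalIntegrable
    fun_prop
  intro u hu
  obtain ⟨hu1, hu2⟩ := hu
  have hfac := wP_fac u (by linarith) hu2
  have hw0 : 0 ≤ wP u := by unfold wP; positivity
  have hint : u ^ k * ((√2*(1+√3)) ^ 2 - (u + (1+√3)) ^ 2) ^ p = u * wP u ^ p := by
    rw [wP, Real.mul_rpow (by positivity) hfac, ← mul_assoc]
    congr 1
    rw [← Real.rpow_natCast u 2, ← Real.rpow_mul (by linarith), hp]
    rw [show ((2:ℕ):ℝ) * (((k:ℝ) - 1)/2) = ((k-1 : ℕ):ℝ) by push_cast [Nat.cast_sub hk]; ring]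
    rw [Real.rpow_natCast, ← pow_succ']
    congr 1; omega
  rw [hint, rp2 _ _ hw0 hp0]
  obtain ⟨x, rfl⟩ : ∃ x, u = 1 + x := ⟨u-1, by ring⟩
  have hx : 0 ≤ x := by linarith
  have hp1 := aux_poly1 x (1 - wP (1+x)) hx (by linarith [end_bd.2]) (by rw [wP_eq]; ring)
  have h3 : 0 < 1 + √3 := by positivity
  have hpw : 0 ≤ wP (1+x) ^ p := Real.rpow_nonneg hw0 _
  rw [wP'_eq]
  calc (1+x) * wP (1+x) ^ p = ((1+x) * wP (1+x) ^ p) * 1 := by ring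
    _ ≤ ((1+x) * wP (1+x) ^ p) * ((1+(1+2*√3)*x+(√3-1)*x^2) * (1 - 37/50*(1 - wP (1+x)) + 1/2*(1 - wP (1+x))^2)) := by
        gcongr
    _ = _ := by field_simp; ring

lemma IV_ge (k : ℕ) (hk : 1 ≤ k) :
    1/(2*(1+√3)) * (2/5/(((k:ℝ) + 1)/2+1) + 0/(((k:ℝ) + 1)/2+2) + 3/5/(((k:ℝ) + 1)/2+3)) ≤
    ∫ u in (1:ℝ)..(√2*(1+√3) - (1+√3)), u ^ k * ((√2*(1+√3)) ^ 2 - (u + (1+√3)) ^ 2) ^ (((k:ℝ) + 1)/2) := by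
  have hk' : (1:ℝ) ≤ k := by exact_mod_cast hk
  set p := ((k:ℝ) + 1)/2 with hp
  have hp0 : 0 ≤ p := by rw [hp]; linarith
  have key := aux_ftc wP wP' 1 (√2*(1+√3) - (1+√3)) wP_deriv wP'_cont p hp0 (2/5) 0 (3/5)
  rw [wP_one, wP_end, Real.zero_rpow (by positivity), Real.zero_rpow (by positivity),
    Real.zero_rpow (by positivity), Real.one_rpow, Real.one_rpow, Real.one_rpow] at key
  have hR : 1/(2*(1+√3)) * (2/5/(p+1) + 0/(p+2) + 3/5/(p+3)) =
      ∫ x in (1:ℝ)..(√2*(1+√3) - (1+√3)), (-1/(2*(1+√3))) *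
        (wP' x * (2/5 * wP x ^ p + 0 * wP x ^ (p+1) + 3/5 * wP x ^ (p+2))) := by
    rw [intervalIntegral.integral_const_mul, key]; ring
  rw [hR]
  have hw : Continuous wP := continuous_iff_continuousAt.2 fun x => (wP_deriv x).continuousAt
  have c0 : ∀ q : ℝ, 0 ≤ q → Continuous fun x => wP x ^ q := fun q hq =>
    hw.rpow_const fun x => Or.inr hq
  have c1 := c0 p hp0
  have c2 := c0 (p+1) (by linarith)
  have c3 := c0 (p+2) (by linarith)
  have c4 := wP'_cont
  apply integral_mono_on end_bd.1
  · apply Continuous.intervalIntegrable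
    fun_prop
  · apply Continuous.intervalIntegrable
    apply Continuous.mul (by fun_prop)
    exact Continuous.rpow_const (by fun_prop) fun x => Or.inr hp0
  intro u hu
  obtain ⟨hu1, hu2⟩ := hu
  have hfac := wP_fac u (by linarith) hu2
  have hw0 : 0 ≤ wP u := by unfold wP; positivity
  have hu0 : 0 < u := by linarith
  have hint : u ^ k * ((√2*(1+√3)) ^ 2 - (u + (1+√3)) ^ 2) ^ p = wP u ^ p / u := by
    rw [eq_div_iff hu0.ne', wP, Real.mul_rpow (by positivity) hfac]
    have : (u^2)^p = u^k*u := by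
      rw [← Real.rpow_natCast u 2, ← Real.rpow_mul (by linarith), hp]
      rw [show ((2:ℕ):ℝ) * (((k:ℝ) + 1)/2) = ((k+1 : ℕ):ℝ) by push_cast; ring]
      rw [Real.rpow_natCast, pow_succ]
    rw [this]; ring
  rw [hint, rp2 _ _ hw0 hp0]
  obtain ⟨x, rfl⟩ : ∃ x, u = 1 + x := ⟨u-1, by ring⟩
  have hx : 0 ≤ x := by linarith
  have hp1 := aux_poly2 x (1 - wP (1+x)) hx (by linarith [end_bd.2]) (by rw [wP_eq]; ring)
  have h3 : 0 < 1 + √3 := by positivity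
  have hpw : 0 ≤ wP (1+x) ^ p := Real.rpow_nonneg hw0 _
  rw [wP'_eq]
  calc _ = (wP (1+x) ^ p / (1+x)) * ((1+x)^2*(1+(1+2*√3)*x+(√3-1)*x^2) * (1 - 6/5*(1 - wP (1+x)) + 3/5*(1 - wP (1+x))^2)) := by
          field_simp; ring
    _ ≤ (wP (1+x) ^ p / (1+x)) * 1 := by gcongr
    _ = _ := by ring
lemma sJ_deriv (x : ℝ) : HasDerivAt (fun t : ℝ => 1 - t^2) ((fun t : ℝ => -2*t) x) x := by
  have := (hasDerivAt_pow 2 x).const_sub 1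
  refine this.congr_deriv ?_
  simp

lemma J_ge (p : ℝ) (hp : 0 ≤ p) :
    (1/2) * ((3/4:ℝ)^(p+1) * (5/27/(p+1) + (3/4) * (125/54) / (p+2))) ≤ ∫ t in (1/2:ℝ)..1, (1 - t^2)^p := by
  have key := aux_ftc (fun t : ℝ => 1 - t^2) (fun t : ℝ => -2*t) (1/2) 1 sJ_deriv (by fun_prop) p hp (5/27) (125/54) 0
  have e2 : (3/4:ℝ)^(p+2) = (3/4)^(p+1) * (3/4) := by
    rw [show p+2 = p+1+1 by ring, Real.rpow_add_one (by norm_num)]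
  rw [show (1:ℝ)-1^2 = 0 by norm_num, show (1:ℝ)-(1/2)^2 = 3/4 by norm_num,
    Real.zero_rpow (by positivity), Real.zero_rpow (by positivity),
    Real.zero_rpow (by positivity), e2] at key
  have hR : (1/2) * ((3/4:ℝ)^(p+1) * (5/27/(p+1) + (3/4) * (125/54) / (p+2))) =
    ∫ t in (1/2:ℝ)..1, (-1/2) * (-2*t * (5/27 * (1-t^2)^p + 125/54 * (1-t^2)^(p+1) + 0 * (1-t^2)^(p+2))) := by
    rw [intervalIntegral.integral_const_mul, key]; ring
  rw [hR]
  have c0 : ∀ q : ℝ, 0 ≤ q → Continuous fun x : ℝ => (1-x^2) ^ q := fun q hq =>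
    Continuous.rpow_const (by fun_prop) fun x => Or.inr hq
  have c1 := c0 p hp
  have c2 := c0 (p+1) (by linarith)
  have c3 := c0 (p+2) (by linarith)
  apply integral_mono_on (by norm_num)
  · apply Continuous.intervalIntegrable
    fun_prop
  · apply Continuous.intervalIntegrable
    fun_prop
  intro t ht
  obtain ⟨h1, h2⟩ := ht
  have hs : 0 ≤ 1 - t^2 := by nlinarith
  rw [rp2 _ _ hs hp]
  have hpw : 0 ≤ (1-t^2) ^ p := Real.rpow_nonneg hs _
  calc _ = (1-t^2)^p * (t * (5/27 + 125/54 * (1-t^2))) := by ring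
    _ ≤ (1-t^2)^p * 1 := by
      gcongr
      nlinarith [mul_nonneg (sq_nonneg (5*t-3)) (by linarith : 0 ≤ 5*t+6)]
    _ = _ := by ring

lemma J_rec (p : ℝ) (hp : 0 ≤ p) :
    (2*p+3) * ∫ t in (1/2:ℝ)..1, (1 - t^2)^(p+1) =
      (2*p+2) * (∫ t in (1/2:ℝ)..1, (1 - t^2)^p) - 1/2 * (3/4:ℝ)^(p+1) := by
  have c0 : ∀ q : ℝ, 0 ≤ q → Continuous fun x : ℝ => (1-x^2) ^ q := fun q hq =>
    Continuous.rpow_const (by fun_prop) fun x => Or.inr hq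
  have c1 := c0 p hp
  have c2 := c0 (p+1) (by linarith)
  have key : ∫ t in (1/2:ℝ)..1, ((2*p+3) * (1-t^2)^(p+1) - (2*p+2) * (1-t^2)^p) =
      1 * (1-1^2:ℝ)^(p+1) - (1/2) * (1-(1/2)^2:ℝ)^(p+1) := by
    refine integral_eq_sub_of_hasDerivAt (f := fun t : ℝ => t * (1-t^2)^(p+1)) (fun t ht => ?_) ?_
    · rw [Set.uIcc_of_le (by norm_num)] at ht
      have hs : 0 ≤ 1 - t^2 := by nlinarith [ht.1, ht.2]
      have := (hasDerivAt_id t).mul ((sJ_deriv t).rpow_const (p := p+1) (Or.inr (by linarith)))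
      refine this.congr_deriv ?_
      have e1 : (1-t^2)^(p+1) = (1-t^2)^p*(1-t^2) := by
        rw [Real.rpow_add_of_nonneg hs hp (by norm_num), Real.rpow_one]
      simp only [id, add_sub_cancel_right]
      rw [e1]; ring
    · apply Continuous.intervalIntegrable
      fun_prop
  rw [intervalIntegral.integral_sub ((c2.const_mul _).intervalIntegrable _ _) ((c1.const_mul _).intervalIntegrable _ _),
    intervalIntegral.integral_const_mul, intervalIntegral.integral_const_mul,
    show (1:ℝ)-1^2 = 0 by norm_num, show (1:ℝ)-(1/2)^2 = 3/4 by norm_num,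
    Real.zero_rpow (by positivity)] at key
  linarith

lemma Gamma_half (x : ℝ) (hx : 0 < x) : Real.Gamma (x+1/2) ≤ Real.Gamma (x+1) / √x := by
  have h := Real.Gamma_mul_add_mul_le_rpow_Gamma_mul_rpow_Gamma (s := x) (t := x+1) (a := 1/2) (b := 1/2) hx
    (by linarith) (by norm_num) (by norm_num) (by norm_num)
  rw [show 1/2*x+1/2*(x+1) = x+1/2 by ring, ← Real.sqrt_eq_rpow, ← Real.sqrt_eq_rpow] at h
  have g0 := Real.Gamma_pos_of_pos hx
  rw [Real.Gamma_add_one hx.ne'] at h ⊢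
  rw [← Real.sqrt_mul g0.le] at h
  rw [show Real.Gamma x * (x * Real.Gamma x) = x * (Real.Gamma x)^2 by ring,
    Real.sqrt_mul hx.le, Real.sqrt_sq g0.le] at h
  refine h.trans (le_of_eq ?_)
  rw [eq_div_iff (by positivity)]
  nlinarith [Real.sq_sqrt hx.le]

lemma omega_le (m : ℕ) (hm : 1 ≤ m) :
    (Real.pi ^ ((m:ℝ)/2) / Real.Gamma ((m:ℝ)/2+1))^2 ≤
      (Real.pi ^ ((m:ℝ)-1/2) / Real.Gamma ((m:ℝ)+1/2)) * (2^m * √2 / m) := by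
  have hm' : (0:ℝ) < m := by exact_mod_cast hm
  have g1 := Gamma_half m hm'
  have g2 := Gamma_half ((m:ℝ)/2) (by positivity)
  have d := Real.Gamma_mul_Gamma_add_half ((m:ℝ)/2+1/2)
  rw [show (m:ℝ)/2+1/2+1/2 = m/2+1 by ring, show 2*((m:ℝ)/2+1/2) = m+1 by ring,
    show (1:ℝ) - (m+1) = -m by ring, Real.rpow_neg (by norm_num), Real.rpow_natCast] at d
  have p1 : 0 < Real.Gamma ((m:ℝ)+1/2) := Real.Gamma_pos_of_pos (by positivity)
  have p2 : 0 < Real.Gamma ((m:ℝ)+1) := Real.Gamma_pos_of_pos (by positivity)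
  have p3 : 0 < Real.Gamma ((m:ℝ)/2+1) := Real.Gamma_pos_of_pos (by positivity)
  have p4 : 0 < Real.Gamma ((m:ℝ)/2+1/2) := Real.Gamma_pos_of_pos (by positivity)
  set a := Real.Gamma ((m:ℝ)+1/2)
  set b := Real.Gamma ((m:ℝ)+1)
  set c := Real.Gamma ((m:ℝ)/2+1)
  set e := Real.Gamma ((m:ℝ)/2+1/2)
  have hpi := Real.pi_pos
  have e1 : (Real.pi ^ ((m:ℝ)/2))^2 = Real.pi^((m:ℝ)-1/2) * √Real.pi := by
    rw [Real.sqrt_eq_rpow, ← Real.rpow_add hpi, ← Real.rpow_natCast, ← Real.rpow_mul hpi.le]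
    congr 1; push_cast; ring
  have hs : √(m:ℝ) * √((m:ℝ)/2) = m/√2 := by
    rw [← Real.sqrt_mul hm'.le, show (m:ℝ)*(m/2) = m^2/2 by ring, Real.sqrt_div (by positivity),
      Real.sqrt_sq hm'.le]
  have main : √Real.pi * a / c^2 ≤ 2^m * √2 / m := by
    have sp : 0 < √Real.pi := Real.sqrt_pos.2 hpi
    have hb : √Real.pi * b = 2^m * (e * c) := by rw [d]; field_simp
    have : a * e ≤ (b/√m) * (c/√((m:ℝ)/2)) := by gcongr
    have h2 : (b/√m) * (c/√((m:ℝ)/2)) = b*c*√2/m := by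
      rw [div_mul_div_comm, hs]; field_simp
    rw [h2] at this
    rw [div_le_div_iff₀ (by positivity) hm']
    rw [le_div_iff₀ hm'] at this
    have h3 : (√Real.pi * a * m) * (e*b) ≤ (2^m * √2 * c^2) * (e*b) := by
      calc (√Real.pi * a * m) * (e*b) = (a*e*m) * (√Real.pi*b) := by ring
        _ ≤ (b*c*√2) * (√Real.pi*b) := by gcongr
        _ = _ := by rw [hb]; ring
    exact le_of_mul_le_mul_right h3 (by positivity)
  calc _ = (Real.pi^((m:ℝ)-1/2) / a) * (√Real.pi * a / c^2) := by
        rw [div_pow, e1]; field_simp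
    _ ≤ _ := by gcongr
lemma final_num (m : ℕ) (hm : 2 ≤ m) (A R J : ℝ)
    (hA : A = 4/3*(19/25 - 13/50*m/(m+2) + 1/2*m/(m+4)) - 2*m/(3*(2*m-1)))
    (hR : R = 0.5773+0.4227*(m*(2/5/(m+2)+3/5/(m+6))))
    (hJ : J = 1/2*m*(5/27/(m+1/2) + (3/4)*(125/54)/(m+3/2))) :
    0 < A ∧ 0 < R ∧ 1.41422 * A^(2*m) < J * R^(2*m-1) := by
  rcases Nat.lt_or_ge m 10 with h | h
  · interval_cases m <;> norm_num at hA hR hJ <;> subst hA hR hJ <;> norm_num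
  · have hm' : (10:ℝ) ≤ m := by exact_mod_cast h
    have hR0 : 0 < R := by rw [hR]; positivity
    have hR1 : R ≤ 1 := by
      have e : R = 1 - 0.4227*(2*m*(2/5)*0 + (4/5/(m+2) + 18/5/(m+6))) := by
        rw [hR]; field_simp; ring
      rw [e]
      have : 0 ≤ 4/5/((m:ℝ)+2) + 18/5/((m:ℝ)+6) := by positivity
      linarith
    have hA0 : 0 < A := by
      obtain ⟨x, hx, hx0⟩ : ∃ x : ℝ, (m:ℝ) = x + 10 ∧ 0 ≤ x := ⟨m-10, by ring, by linarith⟩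
      rw [hA, hx]
      have : 0 < 2*(x+10)-1 := by linarith
      have e : 4/3*(19/25 - 13/50*(x+10)/(x+10+2) + 1/2*(x+10)/(x+10+4)) - 2*(x+10)/(3*(2*(x+10)-1))
        = (4/3*(19/25*(x+12)*(x+14) - 13/50*(x+10)*(x+14) + 1/2*(x+10)*(x+12))*(3*(2*x+19)) - 2*(x+10)*(x+12)*(x+14))/((x+12)*(x+14)*(3*(2*x+19))) := by
        rw [show 2*(x+10)-1 = 2*x+19 by ring, show x+10+2 = x+12 by ring, show x+10+4 = x+14 by ring]
        field_simp
      rw [e]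
      apply div_pos _ (by positivity)
      ring_nf
      positivity
    have hAR : A ≤ R * (1 - 0.275/m) := by
      obtain ⟨x, hx, hx0⟩ : ∃ x : ℝ, (m:ℝ) = x + 10 ∧ 0 ≤ x := ⟨m-10, by ring, by linarith⟩
      rw [hA, hR, hx]
      rw [← sub_nonneg]
      rw [show 2*(x+10)-1 = 2*x+19 by ring, show x+10+2 = x+12 by ring, show x+10+4 = x+14 by ring,
        show x+10+6 = x+16 by ring]
      have e : (0.5773+0.4227*((x+10)*(2/5/(x+12)+3/5/(x+16))))*(1 - 0.275/(x+10)) - 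
        (4/3*(19/25 - 13/50*(x+10)/(x+12) + 1/2*(x+10)/(x+14)) - 2*(x+10)/(3*(2*x+19)))
        = ((0.5773*(x+12)*(x+16)+0.4227*((x+10)*(2/5*(x+16)+3/5*(x+12))))*(x+10 - 0.275)*(x+14)*(3*(2*x+19)) - 
        (4/3*(19/25*(x+12)*(x+14) - 13/50*(x+10)*(x+14) + 1/2*(x+10)*(x+12))*(3*(2*x+19)) - 2*(x+10)*(x+12)*(x+14))*(x+16)*(x+10))/((x+12)*(x+14)*(3*(2*x+19))*(x+10)*(x+16)) := by
        field_simp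
      rw [e]
      apply div_nonneg _ (by positivity)
      ring_nf
      positivity
    refine ⟨hA0, hR0, ?_⟩
    have hz : 0 ≤ 1 - 0.275/(m:ℝ) := by
      rw [sub_nonneg, div_le_one (by linarith)]; linarith
    have h1 : (1 - 0.275/(m:ℝ))^(2*m) ≤ 0.588 := by
      calc (1 - 0.275/(m:ℝ))^(2*m) ≤ (Real.exp (-(0.275/(m:ℝ))))^(2*m) := by
            gcongr; exact Real.one_sub_le_exp_neg _
        _ = Real.exp (-0.55) := by
            rw [← Real.exp_nat_mul]; congr 1; push_cast; field_simp; norm_num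
        _ ≤ 0.588 := by
            rw [Real.exp_neg]
            have := Real.quadratic_le_exp_of_nonneg (x := 0.55) (by norm_num)
            apply inv_le_of_inv_le₀ (by norm_num)
            refine le_trans ?_ this
            norm_num
    have hJ1 : 0.84 ≤ J := by
      obtain ⟨x, hx, hx0⟩ : ∃ x : ℝ, (m:ℝ) = x + 10 ∧ 0 ≤ x := ⟨m-10, by ring, by linarith⟩
      rw [hJ, hx, ← sub_nonneg, show x+10+1/2=x+21/2 by ring, show x+10+3/2=x+23/2 by ring]
      have e : 1/2*(x+10)*(5/27/(x+21/2) + (3/4)*(125/54)/(x+23/2)) - 0.84 = 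
        (1/2*(x+10)*(5/27*(x+23/2) + (3/4)*(125/54)*(x+21/2)) - 0.84*(x+21/2)*(x+23/2))/((x+21/2)*(x+23/2)) := by
        field_simp
      rw [e]
      apply div_nonneg _ (by positivity)
      ring_nf
      positivity
    have hRp : 0 < R^(2*m-1) := by positivity
    calc 1.41422 * A^(2*m) ≤ 1.41422 * (R * (1 - 0.275/m))^(2*m) := by gcongr
      _ = 1.41422 * (R^(2*m-1)*R) * (1 - 0.275/m)^(2*m) := by
          rw [mul_pow, ← pow_succ, show 2*m-1+1 = 2*m by omega]; ring
      _ ≤ 1.41422 * (R^(2*m-1)*1) * 0.588 := by gcongr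
      _ < 0.84 * R^(2*m-1) := by nlinarith
      _ ≤ _ := by gcongr
lemma quot_lt (n : ℕ) (hn : 1 ≤ n) (X B Y : ℝ) (hB : 0 < B) (hY : 0 < Y)
    (h : X^n < Y * B^(n-1)) :
    X / B^(((n:ℝ)-1)/n) < Y / Y^(((n:ℝ)-1)/n) := by
  have hn0 : (n:ℝ) ≠ 0 := by positivity
  have hp : ∀ C : ℝ, 0 < C → (C^(((n:ℝ)-1)/n))^n = C^(n-1) := by
    intro C hC
    rw [← Real.rpow_natCast (C^(((n:ℝ)-1)/n)) n, ← Real.rpow_mul hC.le, div_mul_cancel₀ _ hn0,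
      ← Real.rpow_natCast, Nat.cast_sub hn, Nat.cast_one]
  apply lt_of_pow_lt_pow_left₀ n (by positivity)
  rw [div_pow, div_pow, hp B hB, hp Y hY]
  rw [div_lt_iff₀ (by positivity)]
  have : Y^n / Y^(n-1) = Y := by
    rw [div_eq_iff (by positivity), ← pow_succ']; congr 1; omega
  rw [this]; exact h

lemma lambdaPlane_eq (k : ℕ) (hk : (1:ℝ) ≤ k) :
    lambdaPlane (2*(k+1)) =
      2*((k:ℝ)+1) * (2 * (Real.pi ^ (((k+1:ℕ):ℝ)-1/2) / Real.Gamma (((k+1:ℕ):ℝ)+1/2)) *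
        ∫ t in (1/2:ℝ)..1, (1 - t^2)^((k:ℝ)-1/2+1)) /
      (2 * (Real.pi ^ (((k+1:ℕ):ℝ)-1/2) / Real.Gamma (((k+1:ℕ):ℝ)+1/2)) *
        ∫ t in (1/2:ℝ)..1, (1 - t^2)^((k:ℝ)-1/2+1)) ^ ((((2*(k+1) : ℕ):ℝ)-1)/((2*(k+1) : ℕ):ℝ)) := by
  have h := J_rec ((k:ℝ)-1/2) (by linarith)
  have e1 : (((2*(k+1):ℕ):ℝ)-1)/2 = (k:ℝ)-1/2+1 := by push_cast; ring
  have e2 : (((2*(k+1):ℕ):ℝ)-3)/2 = (k:ℝ)-1/2 := by push_cast; ring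
  have e3 : (((2*(k+1):ℕ):ℝ)+1)/2 = ((k+1:ℕ):ℝ)+1/2 := by push_cast; ring
  have e5 : (k:ℝ)-1/2+1 = ((k+1:ℕ):ℝ)-1/2 := by push_cast; ring
  have e4 : (√3/2)^(((2*(k+1):ℕ):ℝ)-1) = (3/4:ℝ)^((k:ℝ)-1/2+1) := by
    have : √3/2 = (3/4:ℝ)^(1/2:ℝ) := by
      rw [← Real.sqrt_eq_rpow, Real.sqrt_div (by norm_num), show (4:ℝ) = 2^2 by norm_num,
        Real.sqrt_sq (by norm_num)]
    rw [this, ← Real.rpow_mul (by norm_num)]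
    congr 1; push_cast; ring
  unfold lambdaPlane
  simp only [e1, e2, e3, e4]
  rw [show π^((k:ℝ)-1/2+1) = π^(((k+1:ℕ):ℝ)-1/2) by rw [e5]]
  congr 1
  generalize (∫ t in (1/2:ℝ)..1, (1 - t^2)^((k:ℝ)-1/2+1)) = J2 at *
  generalize (∫ t in (1/2:ℝ)..1, (1 - t^2)^((k:ℝ)-1/2)) = J1 at *
  generalize π ^ (((k+1:ℕ):ℝ)-1/2) / Real.Gamma (((k+1:ℕ):ℝ)+1/2) = o
  generalize (3/4:ℝ)^((k:ℝ)-1/2+1) = z at *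
  push_cast
  linear_combination (-2*o)*h

lemma lawson_eq (k : ℕ) (hk : 1 ≤ k) :
    lawsonCompetitorEnergy k k =
      ((Real.pi ^ (((k+1:ℕ):ℝ)/2) / Real.Gamma (((k+1:ℕ):ℝ)/2+1))^2 * (2*((k:ℝ)+1)) *
        (((k:ℝ)+1)*(√2*(1+√3)) * (∫ u in (1:ℝ)..(√2*(1+√3) - (1+√3)), u ^ k * ((√2*(1+√3)) ^ 2 - (u + (1+√3)) ^ 2) ^ (((k:ℝ) - 1)/2))
          - √2*((k:ℝ)+1)/(2*(2*((k:ℝ)+1)-1)))) /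
      ((Real.pi ^ (((k+1:ℕ):ℝ)/2) / Real.Gamma (((k+1:ℕ):ℝ)/2+1))^2 *
        (1 + 2*((k:ℝ)+1) * (∫ u in (1:ℝ)..(√2*(1+√3) - (1+√3)), u ^ k * ((√2*(1+√3)) ^ 2 - (u + (1+√3)) ^ 2) ^ (((k:ℝ) + 1)/2))))
        ^ ((((2*(k+1) : ℕ):ℝ)-1)/((2*(k+1) : ℕ):ℝ)) := by
  have hk0 : (k:ℝ) ≠ 0 := by positivity
  have sp2 : 0 < √2 := by positivity
  have s3 : √3^2 = 3 := aux_s3.2.2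
  have t3 : √2^2 = 2 := aux_s2.2.2
  have sp3 : 1 < √3 := by linarith [aux_s3.1]
  have e0 : √((k:ℝ)/k) = 1 := by rw [div_self hk0, Real.sqrt_one]
  have ecos : Real.cos (π/6+π/4) = √2*(√3-1)/4 := by
    rw [Real.cos_add, Real.cos_pi_div_six, Real.cos_pi_div_four, Real.sin_pi_div_six, Real.sin_pi_div_four]
    ring
  have esin : Real.sin (π/6+π/4) = √2*(√3+1)/4 := by
    rw [Real.sin_add, Real.cos_pi_div_six, Real.cos_pi_div_four, Real.sin_pi_div_six, Real.sin_pi_div_four]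
    ring
  have hs1 : √3 - 1 ≠ 0 := by linarith
  have etan : Real.tan (π/6+π/4) = 2 + √3 := by
    rw [Real.tan_eq_sin_div_cos, ecos, esin]
    rw [div_eq_iff (by positivity)]
    linear_combination (-√2/4)*s3
  have einv : 1 / (√2*(√3-1)/4) = √2*(1+√3) := by
    rw [div_eq_iff (by positivity)]
    linear_combination (-√2^2/4)*s3 - t3/2
  have e23 : 2*π/3 - π/4 = π/6+π/4 := by ring
  unfold lawsonCompetitorEnergy
  simp only [e0, Real.arctan_one, e23, ecos, etan, einv, one_mul, one_pow,
    show 2+√3-1 = 1+√3 by ring, show (1:ℝ)+1 = 2 by norm_num]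
  have e1 : ((k+1:ℕ):ℝ)/2 = ((k:ℝ)+1)/2 := by push_cast; ring
  have e2 : (((2*(k+1) : ℕ):ℝ)-1)/((2*(k+1) : ℕ):ℝ) = ((k:ℝ)+k+2-1)/((k:ℝ)+k+2) := by
    push_cast; congr 1 <;> ring
  rw [e1, e2]
  generalize (∫ u in (1:ℝ)..(√2*(1+√3) - (1+√3)), u ^ k * ((√2*(1+√3)) ^ 2 - (u + (1+√3)) ^ 2) ^ (((k:ℝ) - 1)/2)) = IP
  generalize (∫ u in (1:ℝ)..(√2*(1+√3) - (1+√3)), u ^ k * ((√2*(1+√3)) ^ 2 - (u + (1+√3)) ^ 2) ^ (((k:ℝ) + 1)/2)) = IV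
  generalize π ^ (((k:ℝ)+1)/2) / Real.Gamma (((k:ℝ)+1)/2+1) = o
  congr 1
  · have : (k:ℝ)+k+1 ≠ 0 := by positivity
    rw [show 2*((k:ℝ)+1)-1 = k+k+1 by ring]
    field_simp
    ring
  · congr 1
    ring

set_option maxHeartbeats 1000000 in
theorem Mkk_lt_lambdaPlane_even (n : ℕ) (hn : Even n) (h4 : 4 ≤ n) (h2700 : n ≤ 2700) :
    lawsonCompetitorEnergy (n / 2 - 1) (n / 2 - 1) < lambdaPlane n := by
  obtain ⟨k, hk, rfl⟩ : ∃ k, 1 ≤ k ∧ n = 2*(k+1) := by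
    obtain ⟨r, hr⟩ := hn
    exact ⟨r-1, by omega, by omega⟩
  rw [show 2*(k+1)/2-1 = k by omega]
  have hk' : (1:ℝ) ≤ k := by exact_mod_cast hk
  rw [lawson_eq k hk, lambdaPlane_eq k hk']
  have hIP := IP_le k hk
  have hIV := IV_ge k hk
  have hJ := J_ge ((k:ℝ)-1/2+1) (by linarith)
  set IP := ∫ u in (1:ℝ)..(√2*(1+√3) - (1+√3)), u ^ k * ((√2*(1+√3)) ^ 2 - (u + (1+√3)) ^ 2) ^ (((k:ℝ) - 1)/2)
  set IV := ∫ u in (1:ℝ)..(√2*(1+√3) - (1+√3)), u ^ k * ((√2*(1+√3)) ^ 2 - (u + (1+√3)) ^ 2) ^ (((k:ℝ) + 1)/2)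
  set J := ∫ t in (1/2:ℝ)..1, (1 - t^2)^((k:ℝ)-1/2+1)
  have hom := omega_le (k+1) (by omega)
  have hpi := Real.pi_pos
  have hG1 : 0 < Real.Gamma (((k+1:ℕ):ℝ)/2+1) := Real.Gamma_pos_of_pos (by positivity)
  have hG2 : 0 < Real.Gamma (((k+1:ℕ):ℝ)+1/2) := Real.Gamma_pos_of_pos (by positivity)
  have ho1 : 0 < Real.pi ^ (((k+1:ℕ):ℝ)/2) / Real.Gamma (((k+1:ℕ):ℝ)/2+1) := by positivity
  have ho2 : 0 < Real.pi ^ (((k+1:ℕ):ℝ)-1/2) / Real.Gamma (((k+1:ℕ):ℝ)+1/2) := by positivity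
  set o := Real.pi ^ (((k+1:ℕ):ℝ)/2) / Real.Gamma (((k+1:ℕ):ℝ)/2+1)
  set o' := Real.pi ^ (((k+1:ℕ):ℝ)-1/2) / Real.Gamma (((k+1:ℕ):ℝ)+1/2)
  clear_value IP IV J o o'
  obtain ⟨m, hmk⟩ : ∃ m, m = k + 1 := ⟨_, rfl⟩
  have hkm : (k:ℝ) = m - 1 := by rw [hmk]; push_cast; ring
  have hm2 : (2:ℝ) ≤ m := by rw [hmk]; push_cast; linarith
  rw [← hmk] at hom ⊢
  rw [hkm] at hIP hIV hJ ⊢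
  obtain ⟨A, hA⟩ : ∃ A : ℝ, A = 4/3*(19/25 - 13/50*m/(m+2) + 1/2*m/(m+4)) - 2*m/(3*(2*m-1)) := ⟨_, rfl⟩
  obtain ⟨R, hR⟩ : ∃ R : ℝ, R = 0.5773+0.4227*(m*(2/5/(m+2)+3/5/(m+6))) := ⟨_, rfl⟩
  obtain ⟨Q, hQ⟩ : ∃ J : ℝ, J = 1/2*m*(5/27/(m+1/2) + (3/4)*(125/54)/(m+3/2)) := ⟨_, rfl⟩
  obtain ⟨hA0, hR0, hfin⟩ := final_num m (by omega) A R Q hA hR hQ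
  obtain ⟨s1, s2, s3⟩ := aux_s3
  obtain ⟨t1, t2, t3⟩ := aux_s2
  have hh : 0 < 1 + √3 := by positivity
  have hm1 : (0:ℝ) < 2*m-1 := by linarith
  -- A bound
  have bA : (((m:ℝ)-1+1)*(√2*(1+√3)) * IP - √2*((m:ℝ)-1+1)/(2*(2*((m:ℝ)-1+1)-1))) ≤ 3*√2/4*A := by
    have : ((m:ℝ)-1+1)*(√2*(1+√3)) * IP ≤ ((m:ℝ)-1+1)*(√2*(1+√3)) * (1/(2*(1+√3)) * (19/25/(((m:ℝ) - 1 - 1)/2+1) - 13/50/(((m:ℝ)-1 - 1)/2+2) + 1/2/(((m:ℝ)-1 - 1)/2+3))) := by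
      apply mul_le_mul_of_nonneg_left hIP
      have : 0 ≤ (m:ℝ)-1+1 := by linarith
      positivity
    refine (sub_le_sub_right this _).trans (le_of_eq ?_)
    rw [hA, show ((m:ℝ)-1-1)/2+1 = m/2 by ring, show ((m:ℝ)-1-1)/2+2 = (m+2)/2 by ring,
      show ((m:ℝ)-1-1)/2+3 = (m+4)/2 by ring, show (m:ℝ)-1+1 = m by ring]
    field_simp
    ring
  have bB : √3 * R ≤ 1 + 2*((m:ℝ)-1+1)*IV := by
    have : 2*((m:ℝ)-1+1) * (1/(2*(1+√3)) * (2/5/(((m:ℝ)-1 + 1)/2+1) + 0/(((m:ℝ)-1 + 1)/2+2) + 3/5/(((m:ℝ)-1 + 1)/2+3))) ≤ 2*((m:ℝ)-1+1)*IV := by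
      apply mul_le_mul_of_nonneg_left hIV
      linarith
    have e : 2*((m:ℝ)-1+1) * (1/(2*(1+√3)) * (2/5/(((m:ℝ)-1 + 1)/2+1) + 0/(((m:ℝ)-1 + 1)/2+2) + 3/5/(((m:ℝ)-1 + 1)/2+3)))
        = (2/(1+√3)) * (m*(2/5/(m+2)+3/5/(m+6))) := by
      rw [show ((m:ℝ)-1+1)/2+1 = (m+2)/2 by ring, show ((m:ℝ)-1+1)/2+2 = (m+4)/2 by ring,
        show ((m:ℝ)-1+1)/2+3 = (m+6)/2 by ring, show (m:ℝ)-1+1 = m by ring]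
      field_simp
      ring
    have e2 : 2/(1+√3) = √3 - 1 := by
      rw [div_eq_iff hh.ne']; linear_combination -s3
    rw [e, e2] at this
    have hb1 : m*(2/5/((m:ℝ)+2)+3/5/(m+6)) ≤ 1 := by
      have e : m*(2/5/((m:ℝ)+2)+3/5/(m+6)) = 1 - (4/5/(m+2) + 18/5/(m+6)) := by
        field_simp; ring
      rw [e]
      have : 0 ≤ 4/5/((m:ℝ)+2) + 18/5/((m:ℝ)+6) := by positivity
      linarith
    rw [hR]
    nlinarith
  have bJ : (3/4:ℝ)^m * (√3/2) * (Q/m) ≤ J := by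
    refine le_trans (le_of_eq ?_) hJ
    rw [show (m:ℝ)-1-1/2+1+1 = m+1/2 by ring, show (m:ℝ)-1-1/2+1+2 = m+3/2 by ring,
      Real.rpow_add (by norm_num), Real.rpow_natCast, ← Real.sqrt_eq_rpow,
      Real.sqrt_div (by norm_num), show (4:ℝ) = 2^2 by norm_num, Real.sqrt_sq (by norm_num), hQ]
    field_simp
    ring
  have hQ0 : 0 < Q := by rw [hQ]; positivity
  have hJ0 : 0 < J := lt_of_lt_of_le (by positivity) bJ
  have hmain : (o^2*(3*√2/4*A))^(2*m) < (2*o'*J) * (o^2*(√3*R))^(2*m-1) := by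
    have x1 : o^2 * (3*√2/4*A)^(2*m) < (2*o'*J) * (√3*R)^(2*m-1) := by
      have y1 : (3*√2/4*A)^(2*m) = (9/8)^m * A^(2*m) := by
        rw [mul_pow, pow_mul (3*√2/4)]
        congr 2
        rw [div_pow, mul_pow, t3]; norm_num
      have y2 : √3 * (√3*R)^(2*m-1) = 3^m * R^(2*m-1) := by
        rw [mul_pow, ← mul_assoc, ← pow_succ', show 2*m-1+1 = 2*m by omega, pow_mul, s3]
      have y3 : (2:ℝ)^m*(9/8)^m = (9/4)^m := by rw [← mul_pow]; norm_num
      have y4 : (3/4:ℝ)^m*3^m = (9/4)^m := by rw [← mul_pow]; norm_num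
      have hRp : 0 < (√3*R)^(2*m-1) := by positivity
      rw [y1]
      calc o^2 * ((9/8)^m * A^(2*m)) ≤ (o' * (2^m*√2/m)) * ((9/8)^m * A^(2*m)) := by gcongr
        _ = o'/m * (9/4)^m * (√2 * A^(2*m)) := by rw [← y3]; ring
        _ ≤ o'/m * (9/4)^m * (1.41422 * A^(2*m)) := by gcongr
        _ < o'/m * (9/4)^m * (Q * R^(2*m-1)) := by gcongr
        _ = (2*o'*((3/4:ℝ)^m * (√3/2) * (Q/m))) * (√3*R)^(2*m-1) := by
            rw [← y4]
            linear_combination (-(o'/m) * (3/4)^m * Q) * y2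
        _ ≤ _ := by gcongr
    calc (o^2*(3*√2/4*A))^(2*m) = (o^2)^(2*m-1) * (o^2 * (3*√2/4*A)^(2*m)) := by
          rw [mul_pow, ← mul_assoc, ← pow_succ, show 2*m-1+1 = 2*m by omega]
      _ < (o^2)^(2*m-1) * ((2*o'*J) * (√3*R)^(2*m-1)) := by gcongr
      _ = _ := by rw [mul_pow (o^2)]; ring
  have hq := quot_lt (2*m) (by omega) (o^2*(3*√2/4*A)) (o^2*(√3*R)) (2*o'*J)
    (by positivity) (by positivity) hmain
  have hexp : 0 ≤ (((2*m:ℕ):ℝ)-1)/((2*m:ℕ):ℝ) := by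
    apply div_nonneg _ (by positivity)
    push_cast; linarith
  set ex := (((2*m:ℕ):ℝ)-1)/((2*m:ℕ):ℝ)
  clear_value ex
  have hm0 : 0 < 2*((m:ℝ)-1+1) := by linarith
  calc _ ≤ (o^2 * (2*((m:ℝ)-1+1)) * (3*√2/4*A)) / (o^2*(√3*R))^ex := by
        apply div_le_div₀
        · positivity
        · exact mul_le_mul_of_nonneg_left bA (by positivity)
        · positivity
        · exact Real.rpow_le_rpow (by positivity) (mul_le_mul_of_nonneg_left bB (by positivity)) hexp
    _ = (2*((m:ℝ)-1+1)) * ((o^2*(3*√2/4*A))/(o^2*(√3*R))^ex) := by ring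
    _ < (2*((m:ℝ)-1+1)) * ((2*o'*J)/(2*o'*J)^ex) := mul_lt_mul_of_pos_left hq hm0
    _ = _ := by ring
end

section
/- For every even integer n with 8 ≤ n ≤ 2700, setting k := n/2 − 1, the inequality M(k−1, k+1) < Λ_plane(n) holds, where M(k,l) and Λ_plane(n) are the explicit quantities defined in the context. -/
open MeasureTheory Real

lemma cap_poly (lam T N0 B M g p h q s : ℝ) (hlam : 0 < lam) (hg : 0 ≤ g) (hp : 0 < p)
    (hh : 0 ≤ h) (hq : q = g * p + h) (hM : 1 ≤ M) (h0 : p * (p - N0) = lam * h)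
    (h1 : 0 ≤ p * (B - q) - (q + g * p) * (p - N0) + h * (1 - 2 * T * lam))
    (hT : 1 ≤ 2 * T * lam) (h2 : h * (2 * T + lam) ≤ M * p + 2 * g * h * (2 * T * lam - 1))
    (hs : 0 ≤ s) :
    0 ≤ (1 + g * s) * (p + q * s) * (N0 + B * s + M * s ^ 2 - p - q * s)
      + (lam + s) * (1 - 2 * T * s - s ^ 2) * h := by
  have hgp : 0 ≤ g * p := by positivity
  have hq0 : 0 ≤ q := by rw [hq]; positivity
  have hD : 0 ≤ p - N0 := by
    by_contra hc
    push Not at hc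
    have : p * (p - N0) < 0 := mul_neg_of_pos_of_neg hp hc
    have : 0 ≤ lam * h := by positivity
    linarith
  set D := p - N0 with hDdef
  set E := B - q with hEdef
  have hTl : 0 ≤ 2 * T * lam - 1 := by linarith
  have hE : 0 ≤ E := by
    have h3 : 0 ≤ (q + g * p) * D := by positivity
    have h4 : 0 ≤ h * (2 * T * lam - 1) := by positivity
    have : 0 ≤ p * E := by linarith
    exact nonneg_of_mul_nonneg_right this hp
  have hS2 : 0 ≤ M * p + (q + g * p) * E - g * q * D - h * (2 * T + lam) := by
    have e1 : (q + g * p) * ((q + g * p) * D + h * (2 * T * lam - 1)) ≤ (q + g * p) * (p * E) :=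
      mul_le_mul_of_nonneg_left (by linarith) (by positivity)
    have e2 : p * (g * q * D) ≤ (q + g * p) * (q + g * p) * D := by
      have : 0 ≤ (q * q + q * (g * p) + (g * p) * (g * p)) * D := by positivity
      linarith
    have e3 : p * (2 * g * h * (2 * T * lam - 1)) ≤ (q + g * p) * (h * (2 * T * lam - 1)) := by
      have : 0 ≤ h * (h * (2 * T * lam - 1)) := by positivity
      rw [hq]; linarith
    have e4 := mul_le_mul_of_nonneg_left h2 hp.le
    have : 0 ≤ p * (M * p + (q + g * p) * E - g * q * D - h * (2 * T + lam)) := by linarith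
    exact nonneg_of_mul_nonneg_right this hp
  have hS3 : 0 ≤ M * (q + g * p) + g * q * E - h := by
    have : 0 ≤ (M - 1) * (q + g * p) := mul_nonneg (by linarith) (by positivity)
    have : 0 ≤ g * q * E := by positivity
    have : h ≤ q := by rw [hq]; linarith
    linarith
  have hS4 : 0 ≤ M * g * q := by positivity
  have key : (1 + g * s) * (p + q * s) * (N0 + B * s + M * s ^ 2 - p - q * s)
      + (lam + s) * (1 - 2 * T * s - s ^ 2) * h =
      (p * E - (q + g * p) * D + h * (1 - 2 * T * lam)) * s
      + (M * p + (q + g * p) * E - g * q * D - h * (2 * T + lam)) * s ^ 2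
      + (M * (q + g * p) + g * q * E - h) * s ^ 3 + M * g * q * s ^ 4 := by
    have hN : N0 = p - D := by rw [hDdef]; ring
    have hB : B = E + q := by rw [hEdef]; ring
    rw [hN, hB]
    linear_combination (-1 : ℝ) * h0
  rw [key]
  positivity

lemma cap_deriv (k : ℕ) (β d R u : ℝ) (hβ : 0 ≤ β) (hu : 0 ≤ R ^ 2 - (u + d) ^ 2) :
    HasDerivAt (fun u : ℝ => u ^ (k + 1) * (R ^ 2 - (u + d) ^ 2) ^ (β + 1))
      (u ^ k * (R ^ 2 - (u + d) ^ 2) ^ β *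
        (((k : ℝ) + 1) * (R ^ 2 - (u + d) ^ 2) - 2 * (β + 1) * u * (u + d))) u := by
  have h1 : HasDerivAt (fun u : ℝ => u ^ (k + 1)) (((k : ℝ) + 1) * u ^ k) u := by
    simpa using hasDerivAt_pow (k + 1) u
  have h2 : HasDerivAt (fun u : ℝ => R ^ 2 - (u + d) ^ 2) (-(2 * (u + d))) u := by
    have := (((hasDerivAt_id u).add_const d).pow 2).const_sub (R ^ 2)
    simpa using this
  have h3 := h2.rpow_const (p := β + 1) (Or.inr (by linarith))
  have h4 := h1.mul h3
  refine h4.congr_deriv ?_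
  rw [add_sub_cancel_right, Real.rpow_add_one' hu (by linarith)]
  ring

lemma cap_cont (k : ℕ) (β d R : ℝ) (hβ : 0 ≤ β) :
    Continuous (fun u : ℝ => u ^ k * (R ^ 2 - (u + d) ^ 2) ^ β) := by
  refine (continuous_pow k).mul (Continuous.rpow_const (by fun_prop) (fun _ => Or.inr hβ))

lemma cap_f_nonneg {a d R u : ℝ} (ha : 0 < a) (hd : 0 ≤ d) 
    (hu : u ∈ Set.Icc a (R - d)) : 0 ≤ R ^ 2 - (u + d) ^ 2 := by
  obtain ⟨h1, h2⟩ := hu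
  nlinarith

lemma cap_aux (Y A N W h P : ℝ) (hP : P ≠ 0) :
    -(Y * ((-N) * (A / P) + W * ((-h) / P ^ 2))) - Y * A
      = Y / P ^ 2 * (A * P * (N - P) + W * h) := by
  field_simp
  ring

lemma cap_int (k : ℕ) (β a d R g p q : ℝ) (hβ : 0 ≤ β) (ha : 0 < a) (hd : 0 ≤ d) (haR : a ≤ R - d)
    (hg : 0 ≤ g) (hp : 0 < p) (hq : 0 ≤ q)
    (H : ∀ u ∈ Set.Icc a (R - d), 0 ≤ (1 + g * (u - a)) * (p + q * (u - a)) *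
      (2 * (β + 1) * u * (u + d) - ((k : ℝ) + 1) * (R ^ 2 - (u + d) ^ 2) - p - q * (u - a))
      + u * (R ^ 2 - (u + d) ^ 2) * (q - g * p)) :
    ∫ u in a..(R - d), u ^ k * (R ^ 2 - (u + d) ^ 2) ^ β * (1 + g * (u - a))
      ≤ a ^ (k + 1) * (R ^ 2 - (a + d) ^ 2) ^ (β + 1) / p := by
  have hpq : ∀ u ∈ Set.Icc a (R - d), 0 < p + q * (u - a) := by
    intro u hu
    have : 0 ≤ q * (u - a) := mul_nonneg hq (by linarith [hu.1])
    linarith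
  set G : ℝ → ℝ := fun u => u ^ k * (R ^ 2 - (u + d) ^ 2) ^ β *
      ((((k : ℝ) + 1) * (R ^ 2 - (u + d) ^ 2) - 2 * (β + 1) * u * (u + d)) *
        ((1 + g * (u - a)) / (p + q * (u - a)))
        + u * (R ^ 2 - (u + d) ^ 2) * ((g * p - q) / (p + q * (u - a)) ^ 2)) with hG
  have hder : ∀ u ∈ Set.uIcc a (R - d), HasDerivAt
      (fun u : ℝ => u ^ (k + 1) * (R ^ 2 - (u + d) ^ 2) ^ (β + 1) *
        ((1 + g * (u - a)) / (p + q * (u - a)))) (G u) u := by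
    intro u hu
    rw [Set.uIcc_of_le haR] at hu
    have hf := cap_f_nonneg ha hd hu
    have h1 := cap_deriv k β d R u hβ hf
    have h2 : HasDerivAt (fun u : ℝ => 1 + g * (u - a)) g u := by
      simpa using (((hasDerivAt_id u).sub_const a).const_mul g).const_add 1
    have h3 : HasDerivAt (fun u : ℝ => p + q * (u - a)) q u := by
      simpa using (((hasDerivAt_id u).sub_const a).const_mul q).const_add p
    have h4 := h1.mul (h2.div h3 (hpq u hu).ne')
    refine h4.congr_deriv ?_
    rw [hG]
    have := (hpq u hu).ne'
    simp only [Pi.div_apply]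
    rw [Real.rpow_add_one' hf (by linarith)]
    field_simp
    ring
  have hcont : ContinuousOn G (Set.uIcc a (R - d)) := by
    rw [Set.uIcc_of_le haR, hG]
    refine (cap_cont k β d R hβ).continuousOn.mul ?_
    refine ContinuousOn.add (ContinuousOn.mul (by fun_prop) (ContinuousOn.div (by fun_prop) (by fun_prop) fun u hu => (hpq u hu).ne'))
      (ContinuousOn.mul (by fun_prop) (ContinuousOn.div (by fun_prop) (by fun_prop) fun u hu => pow_ne_zero _ (hpq u hu).ne'))
  have hint : IntervalIntegrable G volume a (R - d) := hcont.intervalIntegrable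
  have hFTC := intervalIntegral.integral_eq_sub_of_hasDerivAt hder hint
  have hle : ∫ u in a..(R - d), u ^ k * (R ^ 2 - (u + d) ^ 2) ^ β * (1 + g * (u - a))
      ≤ ∫ u in a..(R - d), -G u := by
    refine intervalIntegral.integral_mono_on haR ?_ hint.neg ?_
    · exact ((cap_cont k β d R hβ).mul (by fun_prop)).intervalIntegrable _ _
    · intro u hu
      have hf := cap_f_nonneg ha hd hu
      have hpu := hpq u hu
      have hu0 : 0 < u := lt_of_lt_of_le ha hu.1
      have e : -G u - u ^ k * (R ^ 2 - (u + d) ^ 2) ^ β * (1 + g * (u - a)) =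
          u ^ k * (R ^ 2 - (u + d) ^ 2) ^ β / (p + q * (u - a)) ^ 2 *
          ((1 + g * (u - a)) * (p + q * (u - a)) *
      (2 * (β + 1) * u * (u + d) - ((k : ℝ) + 1) * (R ^ 2 - (u + d) ^ 2) - p - q * (u - a))
      + u * (R ^ 2 - (u + d) ^ 2) * (q - g * p)) := by
        have hx := cap_aux (u ^ k * (R ^ 2 - (u + d) ^ 2) ^ β) (1 + g * (u - a))
          (2 * (β + 1) * u * (u + d) - ((k : ℝ) + 1) * (R ^ 2 - (u + d) ^ 2))
          (u * (R ^ 2 - (u + d) ^ 2)) (q - g * p) (p + q * (u - a)) hpu.ne'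
        rw [hG]
        simp only
        rw [neg_sub, neg_sub] at hx
        rw [hx]
        ring
      have : 0 ≤ u ^ k * (R ^ 2 - (u + d) ^ 2) ^ β / (p + q * (u - a)) ^ 2 := by positivity
      have := mul_nonneg this (H u hu)
      linarith
  refine hle.trans (le_of_eq ?_)
  rw [intervalIntegral.integral_neg, hFTC]
  have h0 : R ^ 2 - (R - d + d) ^ 2 = 0 := by ring
  rw [h0, Real.zero_rpow (by linarith)]
  simp
  ring

lemma cap_parts (k : ℕ) (β a d R : ℝ) (hβ : 0 ≤ β) (ha : 0 < a) (hd : 0 ≤ d) (haR : a ≤ R - d) :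
    2 * (β + 1) * ∫ u in a..(R - d), u ^ k * (R ^ 2 - (u + d) ^ 2) ^ β * (R ^ 2 - d * (u + d))
      = (2 * (β + 1) + k + 1) * (∫ u in a..(R - d), u ^ k * (R ^ 2 - (u + d) ^ 2) ^ (β + 1))
        + a ^ (k + 1) * (R ^ 2 - (a + d) ^ 2) ^ (β + 1) := by
  have hc := cap_cont k β d R hβ
  have hFTC := intervalIntegral.integral_eq_sub_of_hasDerivAt (a := a) (b := R - d)
    (fun u hu => cap_deriv k β d R u hβ (by
      rw [Set.uIcc_of_le haR] at hu
      exact cap_f_nonneg ha hd hu))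
    ((hc.mul (by fun_prop)).intervalIntegrable _ _)
  have h0 : R ^ 2 - (R - d + d) ^ 2 = 0 := by ring
  rw [h0, Real.zero_rpow (by linarith)] at hFTC
  have e1 : (2 * (β + 1) + k + 1) * (∫ u in a..(R - d), u ^ k * (R ^ 2 - (u + d) ^ 2) ^ (β + 1))
      = ∫ u in a..(R - d), (2 * (β + 1) * (u ^ k * (R ^ 2 - (u + d) ^ 2) ^ β * (R ^ 2 - d * (u + d)))
        + u ^ k * (R ^ 2 - (u + d) ^ 2) ^ β *
        (((k : ℝ) + 1) * (R ^ 2 - (u + d) ^ 2) - 2 * (β + 1) * u * (u + d))) := by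
    rw [← intervalIntegral.integral_const_mul]
    refine intervalIntegral.integral_congr ?_
    intro u hu
    rw [Set.uIcc_of_le haR] at hu
    have hf := cap_f_nonneg ha hd hu
    simp only
    rw [Real.rpow_add_one' hf (by linarith)]
    ring
  rw [e1, intervalIntegral.integral_add, hFTC, intervalIntegral.integral_const_mul]
  · ring
  · exact ((hc.mul (by fun_prop)).const_mul _ |>.intervalIntegrable _ _)
  · exact ((hc.mul (by fun_prop)).intervalIntegrable _ _)


lemma polyA1 (lam r3 : ℝ) (hr : r3^2 = 3) (h1 : 1.732 < r3) (h2 : r3 < 1.7321) (hl : 7/10 ≤ lam) (hl1 : lam ≤ 1) :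
    0 ≤ lam*(r3-lam)*(4*r3*lam+2+2*((1-lam^2)/2)^2) - (r3*(1-17/15*((1-lam^2)/2))*(r3-lam)*lam+(1/2*lam+r3*(1-lam^2)))*lam*(2+1/2*((1-lam^2)/2)) - (2*(r3*(1-17/15*((1-lam^2)/2)))*(r3-lam)*lam+(1/2*lam+r3*(1-lam^2)))*(1/2*lam+r3*(1-lam^2))*((1-lam^2)/2) + (1/2*lam+r3*(1-lam^2))*((1-lam^2)/2)*(r3-lam-2*lam-2*r3*lam^2) := by
  have e : lam*(r3-lam)*(4*r3*lam+2+2*((1-lam^2)/2)^2) - (r3*(1-17/15*((1-lam^2)/2))*(r3-lam)*lam+(1/2*lam+r3*(1-lam^2)))*lam*(2+1/2*((1-lam^2)/2)) - (2*(r3*(1-17/15*((1-lam^2)/2)))*(r3-lam)*lam+(1/2*lam+r3*(1-lam^2)))*(1/2*lam+r3*(1-lam^2))*((1-lam^2)/2) + (1/2*lam+r3*(1-lam^2))*((1-lam^2)/2)*(r3-lam-2*lam-2*r3*lam^2)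
    = ((281155532/10935)+(-324066155/26244)*r3)*(lam-7/10)^0*(1-lam)^8 + ((490199171/2187)+(-2337137705/26244)*r3)*(lam-7/10)^1*(1-lam)^7 + ((3715807565/4374)+(-1180672675/4374)*r3)*(lam-7/10)^2*(1-lam)^6 + ((4000148750/2187)+(-2905987375/6561)*r3)*(lam-7/10)^3*(1-lam)^5 + ((5355196750/2187)+(-2758356250/6561)*r3)*(lam-7/10)^4*(1-lam)^4 + ((4571030000/2187)+(-495170000/2187)*r3)*(lam-7/10)^5*(1-lam)^3 + ((2435050000/2187)+(-403400000/6561)*r3)*(lam-7/10)^6*(1-lam)^2 + ((743000000/2187)+(-38000000/6561)*r3)*(lam-7/10)^7*(1-lam)^1 + ((100000000/2187)+(0)*r3)*(lam-7/10)^8*(1-lam)^0 := by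
    linear_combination ((-13/30)*lam^1*r3^1 + (329/120)*lam^2*r3^0 + (3/10)*lam^3*r3^1 + (-8/15)*lam^4*r3^0 + (7/10)*lam^5*r3^1 + (-31/40)*lam^6*r3^0 + (-17/30)*lam^7*r3^1 + (17/30)*lam^8*r3^0)*hr
  have x : 0 ≤ lam - 7/10 := by linarith
  have y : 0 ≤ 1 - lam := by linarith
  have c0 : 0 ≤ (281155532/10935)+(-324066155/26244)*r3 := by linarith
  have c1 : 0 ≤ (490199171/2187)+(-2337137705/26244)*r3 := by linarith
  have c2 : 0 ≤ (3715807565/4374)+(-1180672675/4374)*r3 := by linarith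
  have c3 : 0 ≤ (4000148750/2187)+(-2905987375/6561)*r3 := by linarith
  have c4 : 0 ≤ (5355196750/2187)+(-2758356250/6561)*r3 := by linarith
  have c5 : 0 ≤ (4571030000/2187)+(-495170000/2187)*r3 := by linarith
  have c6 : 0 ≤ (2435050000/2187)+(-403400000/6561)*r3 := by linarith
  have c7 : 0 ≤ (743000000/2187)+(-38000000/6561)*r3 := by linarith
  have c8 : 0 ≤ (100000000/2187)+(0)*r3 := by linarith
  rw [e]
  positivity

lemma polyA2 (lam r3 : ℝ) (hr : r3^2 = 3) (h1 : 1.732 < r3) (h2 : r3 < 1.7321) (hl : 7/10 ≤ lam) (hl1 : lam ≤ 1) :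
    0 ≤ (r3*lam-1)*(4*r3*lam+2*lam^2-2*((1-lam^2)/2)^2) - (r3*(1-17/15*((1-lam^2)/2))*(r3*lam-1)+(27/20*lam-r3*(1-lam^2)))*lam*(2+27/20*((1-lam^2)/2)) - (2*(r3*(1-17/15*((1-lam^2)/2)))*(r3*lam-1)+(27/20*lam-r3*(1-lam^2)))*(27/20*lam-r3*(1-lam^2))*((1-lam^2)/2) + (27/20*lam-r3*(1-lam^2))*((1-lam^2)/2)*((r3*lam-1)*lam-2*lam-2*r3) := by
  have e : (r3*lam-1)*(4*r3*lam+2*lam^2-2*((1-lam^2)/2)^2) - (r3*(1-17/15*((1-lam^2)/2))*(r3*lam-1)+(27/20*lam-r3*(1-lam^2)))*lam*(2+27/20*((1-lam^2)/2)) - (2*(r3*(1-17/15*((1-lam^2)/2)))*(r3*lam-1)+(27/20*lam-r3*(1-lam^2)))*(27/20*lam-r3*(1-lam^2))*((1-lam^2)/2) + (27/20*lam-r3*(1-lam^2))*((1-lam^2)/2)*((r3*lam-1)*lam-2*lam-2*r3)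
    = ((-235529147/87480)+(136928897/43740)*r3)*(lam-7/10)^0*(1-lam)^7 + ((-1642341407/87480)+(13839929/729)*r3)*(lam-7/10)^1*(1-lam)^6 + ((-74368621/1458)+(135089249/2916)*r3)*(lam-7/10)^2*(1-lam)^5 + ((-141921625/2187)+(250264825/4374)*r3)*(lam-7/10)^3*(1-lam)^4 + ((-65899750/2187)+(26509700/729)*r3)*(lam-7/10)^4*(1-lam)^3 + ((10234750/729)+(7448000/729)*r3)*(lam-7/10)^5*(1-lam)^2 + ((44065000/2187)+(1300000/2187)*r3)*(lam-7/10)^6*(1-lam)^1 + ((13000000/2187)+(0)*r3)*(lam-7/10)^7*(1-lam)^0 := by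
    linear_combination ((1/15)*lam^0*r3^0 + (13/30)*lam^1*r3^1 + (1867/1200)*lam^2*r3^0 + (-3/10)*lam^3*r3^1 + (-61/300)*lam^4*r3^0 + (-7/10)*lam^5*r3^1 + (697/1200)*lam^6*r3^0 + (17/30)*lam^7*r3^1)*hr
  have x : 0 ≤ lam - 7/10 := by linarith
  have y : 0 ≤ 1 - lam := by linarith
  have c0 : 0 ≤ (-235529147/87480)+(136928897/43740)*r3 := by linarith
  have c1 : 0 ≤ (-1642341407/87480)+(13839929/729)*r3 := by linarith
  have c2 : 0 ≤ (-74368621/1458)+(135089249/2916)*r3 := by linarith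
  have c3 : 0 ≤ (-141921625/2187)+(250264825/4374)*r3 := by linarith
  have c4 : 0 ≤ (-65899750/2187)+(26509700/729)*r3 := by linarith
  have c5 : 0 ≤ (10234750/729)+(7448000/729)*r3 := by linarith
  have c6 : 0 ≤ (44065000/2187)+(1300000/2187)*r3 := by linarith
  have c7 : 0 ≤ (13000000/2187)+(0)*r3 := by linarith
  rw [e]
  positivity



set_option maxHeartbeats 1000000 in
lemma cap1_core (k : ℕ) (m lam r3 R η g w T d c p h : ℝ) (hk : (k:ℝ) = m - 2) (hm : 4 ≤ m) (hml : m * lam ^ 2 = m - 2)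
    (hr : r3 ^ 2 = 3) (h1 : 1.732 < r3) (h2 : r3 < 1.7321) (hl : 7/10 ≤ lam) (hl1 : lam ≤ 1)
    (hR : 0 ≤ R) (hηd : η = (1 - lam ^ 2) / 2) (hmη : m * η = 1) (hη0 : 0 < η) (hη1 : η ≤ 1/4)
    (hg : g = r3 * (1 - 17/15 * η)) (hwd : w = r3 - lam) (hTw : T * w = 1 + r3 * lam) (hd0 : 0 ≤ d)
    (hT0 : 0 < T)
    (hlT : lam + d = T) (hRT : R ^ 2 = T ^ 2 + 1) (hcl : c * lam = 1/2 * lam + r3 * (1 - lam ^ 2))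
    (hc0 : 0 < c) (hpw : p * w = lam * (2 * m + 1/2)) (hp0 : 0 < p) (hhw : h * w = p * c) (hh0 : 0 < h) :
    ∫ u in lam..(R - d), u ^ k * (R ^ 2 - (u + d) ^ 2) ^ ((m - 1) / 2) * (1 + g * (u - lam))
      ≤ lam ^ k * w / (2 * m + 1/2) := by
  have hw : 0 < w := by linarith
  have hl0 : 0 < lam := by linarith
  have hm0 : 0 < m := by linarith
  have hg1 : 1.24 ≤ g := by rw [hg]; nlinarith
  have hg0 : 0 ≤ g := by linarith
  have haR : lam ≤ R - d := by
    have : T ≤ R := by nlinarith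
    linarith
  have hD : (p - ((m + 1) * lam * T - (m - 1))) * w = lam * c := by
    have : (p - ((m + 1) * lam * T - (m - 1))) * w = p * w - (m+1) * lam * (T * w) + (m-1) * w := by ring
    rw [this, hpw, hTw, hwd]
    linear_combination (-r3) * hml - hcl
  have hBw : ((m + 1) * (lam + T) + 2 * (m - 1) * T) * w = 4 * m * r3 * lam + 2 * m + 2 * η := by
    have : ((m + 1) * (lam + T) + 2 * (m - 1) * T) * w = (m + 1) * lam * w + (3 * m - 1) * (T * w) := by ring
    rw [this, hTw, hwd]
    linear_combination (-1) * hml - 2 * hηd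
  have hpoly := polyA1 lam r3 hr h1 h2 hl hl1
  have hF : 0 ≤ w * (4 * m * r3 * lam + 2 * m + 2 * η) - (g * w + c) * lam * (2 * m + 1/2)
      - (2 * g * w + c) * (lam * c) + c * (w - 2 * lam * (1 + r3 * lam)) := by
    have : lam * η * (w * (4 * m * r3 * lam + 2 * m + 2 * η) - (g * w + c) * lam * (2 * m + 1/2)
      - (2 * g * w + c) * (lam * c) + c * (w - 2 * lam * (1 + r3 * lam))) =
      lam * w * (4 * r3 * lam * (m * η) + 2 * (m * η) + 2 * η ^ 2) 
       - (g * w * lam + c * lam) * lam * (2 * (m * η) + 1/2 * η)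
      - (2 * g * w * lam + c * lam) * (c * lam) * η + (c * lam) * η * (w - 2 * lam - 2 * r3 * lam ^ 2) := by ring
    have h3 : 0 < lam * η := by positivity
    refine nonneg_of_mul_nonneg_right ?_ h3
    rw [this, hmη, hcl, hg, hηd, hwd]
    refine hpoly.trans (le_of_eq ?_)
    ring
  have hint := cap_int k ((m - 1) / 2) lam d R g p (g * p + h) (by linarith) hl0 hd0 haR hg0 hp0
    (by positivity) (by
      intro u hu
      have hs : 0 ≤ u - lam := by linarith [hu.1]
      have hcp := cap_poly lam T ((m + 1) * lam * T - (m - 1)) ((m + 1) * (lam + T) + 2 * (m - 1) * T) (2 * m) g p h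
        (g * p + h) (u - lam) hl0 hg0 hp0 hh0.le rfl (by linarith)
        (by
          have : (p * (p - ((m + 1) * lam * T - (m - 1)))) * w = (lam * h) * w := by
            linear_combination p * hD - lam * hhw
          exact mul_right_cancel₀ hw.ne' this)
        (by
          have : (p * ((m + 1) * (lam + T) + 2 * (m - 1) * T - (g * p + h)) - (g * p + h + g * p) * (p - ((m + 1) * lam * T - (m - 1))) + h * (1 - 2 * T * lam)) * (w ^ 2)
             = p * (w * (4 * m * r3 * lam + 2 * m + 2 * η) - (g * w + c) * lam * (2 * m + 1/2)
      - (2 * g * w + c) * (lam * c) + c * (w - 2 * lam * (1 + r3 * lam))) := by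
            have e1 : (p * ((m + 1) * (lam + T) + 2 * (m - 1) * T - (g * p + h)) - (g * p + h + g * p) * (p - ((m + 1) * lam * T - (m - 1))) + h * (1 - 2 * T * lam)) * (w ^ 2)
              = p * w * (((m + 1) * (lam + T) + 2 * (m - 1) * T) * w) - p * (g * w * (p * w) + (h * w) * w) - (2 * g * p * w + h * w) * ((p - ((m + 1) * lam * T - (m - 1))) * w) + (h * w) * (w - 2 * (T * w) * lam) := by ring
            rw [e1, hBw, hD, hhw, hTw]
            linear_combination (-p * g * w - p * c) * hpw
          have h5 := mul_nonneg hp0.le hF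
          rw [← this] at h5
          exact nonneg_of_mul_nonneg_left h5 (by positivity))
        (by
          have : (1:ℝ) * w ≤ (2 * T * lam) * w := by
            have : (2 * T * lam) * w = 2 * lam * (T * w) := by ring
            rw [this, hTw, hwd]; nlinarith
          exact le_of_mul_le_mul_right this hw)
        (by
          have h6 : h * (2 * T + lam) ≤ h * (2 * g * (2 * T * lam - 1)) := by
            refine mul_le_mul_of_nonneg_left ?_ hh0.le
            refine le_of_mul_le_mul_right ?_ hw
            have e1 : (2 * T + lam) * w = 2 * (T * w) + lam * w := by ring
            have e2 : (2 * g * (2 * T * lam - 1)) * w = 2 * g * (2 * lam * (T * w) - w) := by ring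
            rw [e1, e2, hTw, hwd]
            have hl7 : 0.707 ≤ lam := by nlinarith
            have h7 : 0 ≤ 2 * lam * (1 + r3 * lam) - (r3 - lam) := by nlinarith
            have h8 := mul_le_mul_of_nonneg_right hg1 h7
            have h9 : 0 ≤ (r3 - 1.732) * (2 * lam ^ 2 - 0.9) := mul_nonneg (by linarith) (by nlinarith)
            have h10 : 0 ≤ (1.7321 - r3) * lam := mul_nonneg (by linarith) (by linarith)
            nlinarith
          have : 0 ≤ 2 * m * p := by positivity
          linarith)
        hs
      have e3 : u + d = T + (u - lam) := by rw [← hlT]; ring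
      rw [e3, hRT, hk]
      convert hcp using 1
      ring)
  refine hint.trans (le_of_eq ?_)
  rw [hlT, hRT]
  rw [show T ^ 2 + 1 - T ^ 2 = 1 by ring, Real.one_rpow, mul_one, div_eq_div_iff hp0.ne' (by positivity)]
  rw [pow_succ]
  linear_combination (-lam ^ k) * hpw

lemma cap1_bound (k : ℕ) (m lam r3 R : ℝ) (hk : (k:ℝ) = m - 2) (hm : 4 ≤ m) (hml : m * lam ^ 2 = m - 2)
    (hr : r3 ^ 2 = 3) (h1 : 1.732 < r3) (h2 : r3 < 1.7321) (hl : 7/10 ≤ lam) (hl1 : lam ≤ 1)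
    (hR : 0 ≤ R) (hRR : R ^ 2 = 4 * (1 + lam ^ 2) / (r3 - lam) ^ 2) :
    ∫ u in lam..(R - (1 + lam ^ 2) / (r3 - lam)), u ^ k *
      (R ^ 2 - (u + (1 + lam ^ 2) / (r3 - lam)) ^ 2) ^ ((m - 1) / 2) *
        (1 + r3 * (1 - 17 / (15 * m)) * (u - lam))
      ≤ lam ^ k * (r3 - lam) / (2 * m + 1/2) := by
  have hw : 0 < r3 - lam := by linarith
  have hl0 : 0 < lam := by linarith
  have hm0 : 0 < m := by linarith
  have hη : (1 - lam ^ 2) / 2 = 1 / m := by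
    field_simp; linarith
  have h3 : 0 ≤ 1 - lam ^ 2 := by nlinarith
  refine cap1_core k m lam r3 R (1 / m) _ (r3 - lam) ((1 + r3 * lam) / (r3 - lam)) _ (1/2 + r3 * (1 - lam ^ 2) / lam)
    (lam * (2 * m + 1/2) / (r3 - lam)) (lam * (2 * m + 1/2) / (r3 - lam) * (1/2 + r3 * (1 - lam ^ 2) / lam) / (r3 - lam))
    hk hm hml hr h1 h2 hl hl1 hR hη.symm (by field_simp) (by positivity) ?_ ?_ rfl (by field_simp) (by positivity) (by positivity)
    ?_ ?_ ?_ (by positivity) (by field_simp) (by positivity) (by field_simp) (by positivity)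
  · rw [div_le_div_iff₀ hm0 (by norm_num)]; linarith
  · field_simp
  · field_simp; ring
  · rw [hRR]; field_simp; linear_combination (-lam ^ 2 - 1) * hr
  · field_simp


set_option maxHeartbeats 1000000 in
lemma cap2_core (l : ℕ) (m lam mu r3 R η g w T d c p h : ℝ) (hk : (l:ℝ) = m) (hm : 4 ≤ m) (hml : m * lam ^ 2 = m - 2)
    (hr : r3 ^ 2 = 3) (h1 : 1.732 < r3) (h2 : r3 < 1.7321) (hl : 7/10 ≤ lam) (hl1 : lam ≤ 1)
    (hmu : mu * lam = 1) (hmu0 : 0 < mu) (hmu1 : 1 ≤ mu)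
    (hR : 0 ≤ R) (hηd : η = (1 - lam ^ 2) / 2) (hmη : m * η = 1) (hη0 : 0 < η) (hη1 : η ≤ 1/4)
    (hg : g = r3 * (1 - 17/15 * η)) (hwd : w = r3 * lam - 1) (hw : 0 < w) (hTw : T * w = r3 + lam) (hd0 : 0 ≤ d)
    (hT0 : 0 < T)
    (hlT : 1 + d = lam * T) (hRT : R ^ 2 = lam ^ 2 * (T ^ 2 + 1)) (hcl : c * lam = 27/20 * lam - r3 * (1 - lam ^ 2))
    (hpw : p * w = 2 * m + 27/20) (hp0 : 0 < p) (hhw : h * w = p * (c * lam)) (hh0 : 0 ≤ h) :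
    ∫ u in (1:ℝ)..(R - d), u ^ l * (R ^ 2 - (u + d) ^ 2) ^ ((m - 3) / 2) * (1 + g * mu * (u - 1))
      ≤ (R ^ 2 - (1 + d) ^ 2) ^ ((m - 3) / 2 + 1) * mu ^ 2 * w / (2 * m + 27/20) := by
  have hl0 : 0 < lam := by linarith
  have hm0 : 0 < m := by linarith
  have hg1 : 1.24 ≤ g := by rw [hg]; nlinarith
  have hg0 : 0 ≤ g := by linarith
  have haR : 1 ≤ R - d := by
    have : (lam * T) ≤ R := by
      have : (lam * T) ^ 2 ≤ R ^ 2 := by rw [hRT]; nlinarith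
      exact le_of_sq_le_sq this hR
    linarith
  have hmul : mu * (m - 2) = m * lam := by
    rw [← hml]; linear_combination (m * lam) * hmu
  have hD : (p - ((m - 1) * T * mu - (m + 1))) * w = c := by
    have : (p - ((m - 1) * T * mu - (m + 1))) * w = p * w - (m - 1) * mu * (T * w) + (m + 1) * w := by ring
    have h3 : ((p - ((m - 1) * T * mu - (m + 1))) * w) * lam = c * lam := by
      rw [this, hpw, hTw, hwd, hcl]
      linear_combination r3 * hml - (m - 1) * (r3 + lam) * hmu
    exact mul_right_cancel₀ hl0.ne' h3
  have hBw : ((m - 1) * (mu + T) + 2 * (m + 1) * T) * w = 4 * m * r3 + 2 * m * lam - 2 * η * mu := by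
    have : ((m - 1) * (mu + T) + 2 * (m + 1) * T) * w = (m - 1) * mu * w + (3 * m + 1) * (T * w) := by ring
    rw [this, hTw, hwd]
    linear_combination (-1) * hmul + 2 * mu * hηd + ((m - 1) * r3 - lam) * hmu
  have hpoly := polyA2 lam r3 hr h1 h2 hl hl1
  have hF : 0 ≤ w * (4 * m * r3 + 2 * m * lam - 2 * η * mu) - (g * w + c * lam) * (2 * m + 27/20)
      - (2 * g * w + c * lam) * c + c * lam * (w - 2 * mu * (r3 + lam)) := by
    have : lam * η * (w * (4 * m * r3 + 2 * m * lam - 2 * η * mu) - (g * w + c * lam) * (2 * m + 27/20)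
      - (2 * g * w + c * lam) * c + c * lam * (w - 2 * mu * (r3 + lam))) =
      w * (4 * r3 * lam * (m * η) + 2 * lam ^ 2 * (m * η) - 2 * η ^ 2 * (mu * lam)) 
       - (g * w + c * lam) * lam * (2 * (m * η) + 27/20 * η)
      - (2 * g * w + c * lam) * (c * lam) * η + (c * lam) * η * (w * lam - 2 * (mu * lam) * (r3 + lam)) := by ring
    have h3 : 0 < lam * η := by positivity
    refine nonneg_of_mul_nonneg_right ?_ h3
    rw [this, hmη, hmu, hcl, hg, hηd, hwd]
    refine hpoly.trans (le_of_eq ?_)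
    ring
  have hT3 : 3 ≤ T := by
    refine le_of_mul_le_mul_right ?_ hw
    rw [hTw, hwd]; nlinarith
  have hTmu : 3 * mu ≤ T * mu := mul_le_mul_of_nonneg_right hT3 hmu0.le
  have hTT : T ≤ T * mu := le_mul_of_one_le_right hT0.le hmu1
  have hcp := fun s hs => cap_poly mu T ((m - 1) * T * mu - (m + 1)) ((m - 1) * (mu + T) + 2 * (m + 1) * T) (2 * m) g p h
        (g * p + h) s hmu0 hg0 hp0 hh0 rfl (by linarith)
        (by
          have : (p * (p - ((m - 1) * T * mu - (m + 1)))) * w = (mu * h) * w := by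
            linear_combination p * hD - mu * hhw - p * c * hmu
          exact mul_right_cancel₀ hw.ne' this)
        (by
          have : (p * ((m - 1) * (mu + T) + 2 * (m + 1) * T - (g * p + h)) - (g * p + h + g * p) * (p - ((m - 1) * T * mu - (m + 1))) + h * (1 - 2 * T * mu)) * (w ^ 2)
             = p * (w * (4 * m * r3 + 2 * m * lam - 2 * η * mu) - (g * w + c * lam) * (2 * m + 27/20)
      - (2 * g * w + c * lam) * c + c * lam * (w - 2 * mu * (r3 + lam))) := by
            have e1 : (p * ((m - 1) * (mu + T) + 2 * (m + 1) * T - (g * p + h)) - (g * p + h + g * p) * (p - ((m - 1) * T * mu - (m + 1))) + h * (1 - 2 * T * mu)) * (w ^ 2)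
              = p * w * (((m - 1) * (mu + T) + 2 * (m + 1) * T) * w) - p * (g * w * (p * w) + (h * w) * w) - (2 * g * p * w + h * w) * ((p - ((m - 1) * T * mu - (m + 1))) * w) + (h * w) * (w - 2 * (T * w) * mu) := by ring
            rw [e1, hBw, hD, hhw, hTw]
            linear_combination (-p * g * w - p * (c * lam)) * hpw
          have h5 := mul_nonneg hp0.le hF
          rw [← this] at h5
          exact nonneg_of_mul_nonneg_left h5 (by positivity))
        (by linarith)
        (by
          have h6 : h * (2 * T + mu) ≤ h * (2 * g * (2 * T * mu - 1)) := by
            refine mul_le_mul_of_nonneg_left ?_ hh0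
            have h8 := mul_le_mul_of_nonneg_right hg1 (show 0 ≤ 2 * T * mu - 1 by linarith)
            linarith
          have : 0 ≤ 2 * m * p := by positivity
          linarith)
        hs
  have hint := cap_int l ((m - 3) / 2) 1 d R (g * mu) (lam ^ 2 * p) (lam * (g * p + h)) (by linarith) one_pos hd0 haR
    (by positivity) (by positivity)
    (by positivity) (by
      intro u hu
      have hs : 0 ≤ mu * (u - 1) := mul_nonneg hmu0.le (by linarith [hu.1])
      have hc := mul_nonneg (show 0 ≤ lam ^ 4 by positivity) (hcp _ hs)
      obtain ⟨s, hsd⟩ : ∃ s, s = mu * (u - 1) := ⟨_, rfl⟩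
      rw [← hsd] at hc
      have hu1 : u = 1 + lam * s := by rw [hsd]; linear_combination (1 - u) * hmu
      have e3 : u + d = lam * (T + s) := by rw [hu1]; linear_combination hlT
      have e4 : g * mu * (u - 1) = g * s := by rw [hsd]; ring
      have e5 : lam * (g * p + h) * (u - 1) = lam ^ 2 * ((g * p + h) * s) := by rw [hu1]; ring
      have e6 : u = lam * (mu + s) := by rw [hu1]; linear_combination - hmu
      have e7 : lam * (g * p + h) - g * mu * (lam ^ 2 * p) = lam * h := by
        linear_combination (- g * lam * p) * hmu
      rw [e7, e5, e4, e3, hRT, hk, e6]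
      refine hc.trans_eq ?_
      ring_nf)
  refine hint.trans (le_of_eq ?_)
  rw [one_pow, one_mul, div_eq_div_iff (by positivity) (by positivity)]
  linear_combination ((R ^ 2 - (1 + d) ^ 2) ^ ((m - 3) / 2 + 1)) * (-hpw - p * w * (mu * lam + 1) * hmu)

lemma cap2_bound (k l : ℕ) (m lam r3 R : ℝ) (hk : (k:ℝ) = m - 2) (hl' : (l:ℝ) = m) (hm : 4 ≤ m) (hml : m * lam ^ 2 = m - 2)
    (hr : r3 ^ 2 = 3) (h1 : 1.732 < r3) (h2 : r3 < 1.7321) (hl : 7/10 ≤ lam) (hl1 : lam ≤ 1)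
    (hR : 0 ≤ R) (hRR : R ^ 2 = 4 * lam ^ 2 * (1 + lam ^ 2) / (r3 * lam - 1) ^ 2) :
    ∫ u in (1:ℝ)..(R - (1 + lam ^ 2) / (r3 * lam - 1)), u ^ l *
      (R ^ 2 - (u + (1 + lam ^ 2) / (r3 * lam - 1)) ^ 2) ^ ((m - 3) / 2) *
        (1 + r3 * (1 - 17 / (15 * m)) * (1 / lam) * (u - 1))
      ≤ lam ^ k * (1 / lam) * (r3 * lam - 1) / (2 * m + 27/20) := by
  have hw : 0 < r3 * lam - 1 := by nlinarith
  have hwne := hw.ne'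
  have hl0 : 0 < lam := by linarith
  have hm0 : 0 < m := by linarith
  have hη : (1 - lam ^ 2) / 2 = 1 / m := by
    field_simp; linarith
  have h3 : 0 ≤ 1 - lam ^ 2 := by nlinarith
  have hη1 : 1 / m ≤ 1 / 4 := by
    rw [div_le_div_iff₀ hm0 (by norm_num)]; linarith
  have hl7 : 0.707 ≤ lam := by nlinarith
  have hc0 : 0 ≤ 27/20 * lam - r3 * (1 - lam ^ 2) := by nlinarith
  have hc1 : 0 ≤ 27/20 - r3 * (1 - lam ^ 2) / lam := by
    have : 27/20 - r3 * (1 - lam ^ 2) / lam = (27/20 * lam - r3 * (1 - lam ^ 2)) / lam := by field_simp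
    rw [this]; positivity
  obtain ⟨w, hwd⟩ : ∃ w, w = r3 * lam - 1 := ⟨_, rfl⟩
  rw [← hwd] at hw hRR ⊢
  have hlT : 1 + (1 + lam ^ 2) / w = lam * ((r3 + lam) / w) := by
    field_simp; rw [hwd]; ring
  have hRT : R ^ 2 = lam ^ 2 * (((r3 + lam) / w) ^ 2 + 1) := by
    rw [hRR]; field_simp; rw [hwd]; linear_combination (-lam ^ 2 - 1) * hr
  have := cap2_core l m lam (1 / lam) r3 R (1 / m) (r3 * (1 - 17 / (15 * m))) w ((r3 + lam) / w) ((1 + lam ^ 2) / w) (27/20 - r3 * (1 - lam ^ 2) / lam)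
    ((2 * m + 27/20) / w) ((2 * m + 27/20) / w * ((27/20 - r3 * (1 - lam ^ 2) / lam) * lam) / w)
    hl' hm hml hr h1 h2 hl hl1 (by field_simp) (by positivity) (by rw [le_div_iff₀ hl0]; linarith) hR hη.symm (by field_simp) (by positivity) hη1 (by field_simp) hwd hw (by field_simp) (by positivity) (by positivity)
    hlT hRT (by field_simp) (by field_simp) (by positivity) (by field_simp) (by positivity)
  refine this.trans (le_of_eq ?_)
  have e1 : R ^ 2 - (1 + (1 + lam ^ 2) / w) ^ 2 = lam ^ 2 := by rw [hRT, hlT]; ring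
  rw [e1]
  have e2 : (lam ^ 2) ^ ((m - 3) / 2 + 1) = lam ^ (k + 1) := by
    rw [← Real.rpow_natCast lam 2, ← Real.rpow_mul hl0.le, ← Real.rpow_natCast lam (k+1)]
    congr 1
    push_cast
    rw [hk]; ring
  rw [e2, pow_succ]
  field_simp


lemma cap_split (k : ℕ) (β a d R : ℝ) (hβ : 0 ≤ β) (ha : 0 < a) (hd : 0 ≤ d) (haR : a ≤ R - d) :
    ∃ J S : ℝ, 0 ≤ J ∧ 0 ≤ S ∧ (∫ u in a..(R - d), u ^ k * (R ^ 2 - (u + d) ^ 2) ^ β) = J ∧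
      (∀ g : ℝ, (∫ u in a..(R - d), u ^ k * (R ^ 2 - (u + d) ^ 2) ^ β * (1 + g * (u - a))) = J + g * S) ∧
      (2 * (β + 1)) * ((R ^ 2 - d * (a + d)) * J - d * S) = (2 * (β + 1) + k + 1) *
        (∫ u in a..(R - d), u ^ k * (R ^ 2 - (u + d) ^ 2) ^ (β + 1))
        + a ^ (k + 1) * (R ^ 2 - (a + d) ^ 2) ^ (β + 1) ∧
      0 ≤ (∫ u in a..(R - d), u ^ k * (R ^ 2 - (u + d) ^ 2) ^ (β + 1)) := by
  have hc := cap_cont k β d R hβ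
  have hi1 : IntervalIntegrable (fun u : ℝ => u ^ k * (R ^ 2 - (u + d) ^ 2) ^ β) volume a (R - d) :=
    hc.intervalIntegrable _ _
  have hi2 : IntervalIntegrable (fun u : ℝ => u ^ k * (R ^ 2 - (u + d) ^ 2) ^ β * (u - a)) volume a (R - d) :=
    (hc.mul (by fun_prop)).intervalIntegrable _ _
  have hnn : ∀ (γ : ℝ), ∀ u ∈ Set.Icc a (R - d), 0 ≤ u ^ k * (R ^ 2 - (u + d) ^ 2) ^ γ := by
    intro γ u hu
    have hf := cap_f_nonneg ha hd hu
    have hu0 : 0 < u := lt_of_lt_of_le ha hu.1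
    positivity
  have hlin : ∀ x y : ℝ, (∫ u in a..(R - d), u ^ k * (R ^ 2 - (u + d) ^ 2) ^ β * (x + y * (u - a))) =
      x * (∫ u in a..(R - d), u ^ k * (R ^ 2 - (u + d) ^ 2) ^ β) +
      y * (∫ u in a..(R - d), u ^ k * (R ^ 2 - (u + d) ^ 2) ^ β * (u - a)) := by
    intro x y
    rw [← intervalIntegral.integral_const_mul, ← intervalIntegral.integral_const_mul,
      ← intervalIntegral.integral_add (hi1.const_mul x) (hi2.const_mul y)]
    congr 1
    ext u
    ring
  refine ⟨_, ∫ u in a..(R - d), u ^ k * (R ^ 2 - (u + d) ^ 2) ^ β * (u - a), ?_, ?_, rfl, ?_, ?_, ?_⟩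
  · exact intervalIntegral.integral_nonneg haR (hnn β)
  · exact intervalIntegral.integral_nonneg haR (fun u hu => mul_nonneg (hnn β u hu) (by linarith [hu.1]))
  · intro g
    rw [hlin, one_mul]
  · rw [← cap_parts k β a d R hβ ha hd haR]
    have := hlin (R ^ 2 - d * (a + d)) (-d)
    rw [neg_mul, ← sub_eq_add_neg] at this
    rw [← this]
    congr 2
    ext u
    ring
  · exact intervalIntegral.integral_nonneg haR (hnn (β + 1))

/-- abstract combination of the two caps -/
lemma combine_alg (m lam r3 σ w1 w2 t g L J1 S1 J2 S2 : ℝ) (hm : 4 ≤ m) (hr : r3 ^ 2 = 3) (hr0 : 0 < r3)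
    (hlam : 0 < lam) (hσ : 0 < σ) (hw1 : 0 < w1) (hw2 : 0 < w2) (hL : 0 < L)
    (ht : 2 - t = (2 * m + 9/10) / (2 * (2 * m - 1))) (hg : g = r3 * (1 - 17 / (15 * m)))
    (hJ1 : 0 ≤ J1) (hJ2 : 0 ≤ J2) (hS1 : 0 ≤ S1) (hS2 : 0 ≤ S2)
    (hb1 : J1 + g * S1 ≤ L * w1 / (2 * m + 1/2))
    (hb2 : J2 + g * (1 / lam) * S2 ≤ L * (1 / lam) * w2 / (2 * m + 27/20)) :
    (2 * σ / w1 * J1 + 2 * lam * σ / w2 * J2 - σ * L / (2 * m - 1) ≤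
      t / (r3 * σ) * ((r3 * σ ^ 2 / w1 * J1 - σ ^ 2 / w1 * S1) + (r3 * lam * σ ^ 2 / w2 * J2 - σ ^ 2 / w2 * S2))) ∧
    2 * σ / w1 * J1 + 2 * lam * σ / w2 * J2 - σ * L / (2 * m - 1) ≤ σ * L * (2 * t / (2 * m + 9/10)) := by
  have h2m : 0 < 2 * m - 1 := by linarith
  have hX : 1 / (2 * m + 1/2) + 1 / (2 * m + 27/20) ≤ 2 / (2 * m + 9/10) := by
    rw [div_add_div _ _ (by positivity) (by positivity), div_le_div_iff₀ (by positivity) (by positivity)]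
    nlinarith
  have h2t : 0 < 2 - t := by rw [ht]; positivity
  have htg : t ≤ (2 - t) * r3 * g := by
    have e1 : t = 2 - (2 * m + 9/10) / (2 * (2 * m - 1)) := by linarith
    have e2 : (2 - t) * r3 * g = 3 * (2 - t) * (1 - 17 / (15 * m)) := by
      rw [hg]; linear_combination ((2 - t) * (1 - 17 / (15 * m))) * hr
    rw [e2, ht, e1]
    have e3 : 3 * ((2 * m + 9 / 10) / (2 * (2 * m - 1))) * (1 - 17 / (15 * m)) - (2 - (2 * m + 9 / 10) / (2 * (2 * m - 1)))
      = (4/5 * m - 153/50) / (2 * m * (2 * m - 1)) := by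
      field_simp; ring
    have : 0 ≤ (4/5 * m - 153/50) / (2 * m * (2 * m - 1)) := div_nonneg (by linarith) (by positivity)
    linarith
  have hg0 : 0 ≤ g := by
    have : 0 ≤ 1 - 17 / (15 * m) := by
      rw [sub_nonneg, div_le_one (by positivity)]; linarith
    rw [hg]; positivity
  have k1 : (2 - t) * σ / w1 * J1 + t * σ / (r3 * w1) * S1 ≤ (2 - t) * σ * L / (2 * m + 1/2) := by
    have e1 : (2 - t) * σ / w1 * (J1 + g * S1) ≤ (2 - t) * σ / w1 * (L * w1 / (2 * m + 1/2)) :=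
      mul_le_mul_of_nonneg_left hb1 (by positivity)
    have e2 : (2 - t) * σ / w1 * (L * w1 / (2 * m + 1/2)) = (2 - t) * σ * L / (2 * m + 1/2) := by
      field_simp
    have e3 : t * σ / (r3 * w1) * S1 ≤ (2 - t) * r3 * g * σ / (r3 * w1) * S1 := by gcongr
    have e4 : (2 - t) * r3 * g * σ / (r3 * w1) * S1 = (2 - t) * σ / w1 * (g * S1) := by
      field_simp
    linarith
  have k2 : (2 - t) * lam * σ / w2 * J2 + t * σ / (r3 * w2) * S2 ≤ (2 - t) * σ * L / (2 * m + 27/20) := by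
    have e1 : (2 - t) * lam * σ / w2 * (J2 + g * (1 / lam) * S2) ≤ (2 - t) * lam * σ / w2 * (L * (1 / lam) * w2 / (2 * m + 27/20)) :=
      mul_le_mul_of_nonneg_left hb2 (by positivity)
    have e2 : (2 - t) * lam * σ / w2 * (L * (1 / lam) * w2 / (2 * m + 27/20)) = (2 - t) * σ * L / (2 * m + 27/20) := by
      field_simp
    have e3 : t * σ / (r3 * w2) * S2 ≤ (2 - t) * r3 * g * σ / (r3 * w2) * S2 := by gcongr
    have e4 : (2 - t) * r3 * g * σ / (r3 * w2) * S2 = (2 - t) * lam * σ / w2 * (g * (1 / lam) * S2) := by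
      field_simp
    linarith
  have k3 : (2 - t) * σ * L / (2 * m + 1/2) + (2 - t) * σ * L / (2 * m + 27/20) ≤ σ * L / (2 * m - 1) := by
    have e1 := mul_le_mul_of_nonneg_left hX (show 0 ≤ (2 - t) * σ * L by positivity)
    have e2 : (2 - t) * σ * L * (2 / (2 * m + 9/10)) = σ * L / (2 * m - 1) := by
      rw [ht]; field_simp
    rw [← e2]
    refine le_trans (le_of_eq ?_) e1
    ring
  constructor
  · have e1 : t / (r3 * σ) * ((r3 * σ ^ 2 / w1 * J1 - σ ^ 2 / w1 * S1) + (r3 * lam * σ ^ 2 / w2 * J2 - σ ^ 2 / w2 * S2))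
      = t * σ / w1 * J1 - t * σ / (r3 * w1) * S1 + t * lam * σ / w2 * J2 - t * σ / (r3 * w2) * S2 := by
      field_simp
      ring
    rw [e1]
    have e2 : 2 * σ / w1 * J1 = (2 - t) * σ / w1 * J1 + t * σ / w1 * J1 := by ring
    have e3 : 2 * lam * σ / w2 * J2 = (2 - t) * lam * σ / w2 * J2 + t * lam * σ / w2 * J2 := by ring
    linarith
  · have j1 : J1 ≤ L * w1 / (2 * m + 1/2) := by
      have : 0 ≤ g * S1 := by positivity
      linarith
    have j2 : J2 ≤ L * (1 / lam) * w2 / (2 * m + 27/20) := by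
      have : 0 ≤ g * (1 / lam) * S2 := by positivity
      linarith
    have e1 : 2 * σ / w1 * J1 ≤ 2 * σ / w1 * (L * w1 / (2 * m + 1/2)) :=
      mul_le_mul_of_nonneg_left j1 (by positivity)
    have e2 : 2 * lam * σ / w2 * J2 ≤ 2 * lam * σ / w2 * (L * (1 / lam) * w2 / (2 * m + 27/20)) :=
      mul_le_mul_of_nonneg_left j2 (by positivity)
    have e3 : 2 * σ / w1 * (L * w1 / (2 * m + 1/2)) + 2 * lam * σ / w2 * (L * (1 / lam) * w2 / (2 * m + 27/20))
      = 2 * σ * L * (1 / (2 * m + 1/2) + 1 / (2 * m + 27/20)) := by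
      field_simp
    have e4 := mul_le_mul_of_nonneg_left hX (show 0 ≤ 2 * σ * L by positivity)
    have e5 : 2 * σ * L * (2 / (2 * m + 9/10)) - σ * L / (2 * m - 1) = σ * L * (2 * t / (2 * m + 9/10)) := by
      have : t = 2 - (2 * m + 9/10) / (2 * (2 * m - 1)) := by linarith
      rw [this]; field_simp
    linarith


set_option maxHeartbeats 1000000 in
lemma combine (k l : ℕ) (m lam r3 σ t d ρ h r : ℝ) (hk : (k:ℝ) = m - 2) (hl' : (l:ℝ) = m) (hm : 4 ≤ m)
    (hml : m * lam ^ 2 = m - 2)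
    (hr : r3 ^ 2 = 3) (h1 : 1.732 < r3) (h2 : r3 < 1.7321) (hl : 7/10 ≤ lam) (hl1 : lam ≤ 1)
    (hσ : 0 < σ) (hσ2 : σ ^ 2 = 1 + lam ^ 2)
    (ht : 2 - t = (2 * m + 9/10) / (2 * (2 * m - 1)))
    (hd : d = (1 + lam ^ 2) / (r3 - lam)) (hρ : ρ = 2 * σ / (r3 - lam))
    (hh : h = (1 + lam ^ 2) / (r3 * lam - 1)) (hrr : r = 2 * lam * σ / (r3 * lam - 1)) :
    ∃ e v : ℝ, ρ * (∫ u in lam..(ρ - d), u ^ k * (ρ ^ 2 - (u + d) ^ 2) ^ (((l:ℝ) - 1)/2))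
      + r * (∫ v in (1:ℝ)..(r - h), v ^ l * (r ^ 2 - (v + h) ^ 2) ^ (((k:ℝ) - 1)/2))
        - lam ^ k * σ / (2 * m - 1) = e ∧
      lam ^ (k + 1)
      + ((k:ℝ) + 1) * (∫ u in lam..(ρ - d), u ^ k * (ρ ^ 2 - (u + d) ^ 2) ^ (((l:ℝ) + 1)/2))
      + ((l:ℝ) + 1) * (∫ v in (1:ℝ)..(r - h), v ^ l * (r ^ 2 - (v + h) ^ 2) ^ (((k:ℝ) + 1)/2)) = v ∧
      0 < v ∧ (m - 1) * (m + 1) * e ≤ t / (r3 * σ) * (2 * m * v) ∧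
      e ≤ σ * lam ^ k * (2 * t / (2 * m + 9/10)) := by
  have hl0 : 0 < lam := by linarith
  have hm0 : 0 < m := by linarith
  have hl5 : 1/2 ≤ lam ^ 2 := by nlinarith
  have hl7 : 0.707 ≤ lam := by nlinarith
  have hw1 : 0 < r3 - lam := by linarith
  have hw2 : 0 < r3 * lam - 1 := by nlinarith
  have hρ0 : 0 ≤ ρ := by rw [hρ]; positivity
  have hr0 : 0 ≤ r := by rw [hrr]; positivity
  have hd0 : 0 ≤ d := by rw [hd]; positivity
  have hh0 : 0 ≤ h := by rw [hh]; positivity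
  have hρρ : ρ ^ 2 = 4 * (1 + lam ^ 2) / (r3 - lam) ^ 2 := by rw [hρ, div_pow, ← hσ2]; congr 1; ring
  have hrr2 : r ^ 2 = 4 * lam ^ 2 * (1 + lam ^ 2) / (r3 * lam - 1) ^ 2 := by rw [hrr, div_pow, ← hσ2]; congr 1; ring
  have hb1 := cap1_bound k m lam r3 ρ hk hm hml hr h1 h2 hl hl1 hρ0 hρρ
  have hb2 := cap2_bound k l m lam r3 r hk hl' hm hml hr h1 h2 hl hl1 hr0 hrr2
  rw [← hd] at hb1
  rw [← hh] at hb2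
  obtain ⟨w1, hw1d⟩ : ∃ w, w = r3 - lam := ⟨_, rfl⟩
  obtain ⟨w2, hw2d⟩ : ∃ w, w = r3 * lam - 1 := ⟨_, rfl⟩
  rw [← hw1d] at hb1 hρ hρρ hd hw1
  rw [← hw2d] at hb2 hrr hrr2 hh hw2
  have hX1 : lam + d = (1 + r3 * lam) / w1 := by rw [hd]; field_simp; rw [hw1d]; ring
  have hX2 : 1 + h = lam * (r3 + lam) / w2 := by rw [hh]; field_simp; rw [hw2d]; ring
  have hf1 : ρ ^ 2 - (lam + d) ^ 2 = 1 := by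
    rw [hX1, hρρ]; field_simp; rw [hw1d]; linear_combination (-lam ^ 2 - 1) * hr
  have hf2 : r ^ 2 - (1 + h) ^ 2 = lam ^ 2 := by
    rw [hX2, hrr2]; field_simp; rw [hw2d]; linear_combination (-lam ^ 2 - 1) * hr
  have haR1 : lam ≤ ρ - d := by
    have : lam + d ≤ ρ := abs_le_of_sq_le_sq' (by linarith) hρ0 |>.2
    linarith
  have haR2 : 1 ≤ r - h := by
    have : 1 + h ≤ r := abs_le_of_sq_le_sq' (by nlinarith) hr0 |>.2
    linarith
  have hg1 : ρ ^ 2 - d * (lam + d) = r3 * σ ^ 2 / w1 := by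
    rw [hρρ, hX1, hd, hσ2]; field_simp; rw [hw1d]; linear_combination (-1) * hr
  have hg2 : r ^ 2 - h * (1 + h) = r3 * lam * σ ^ 2 / w2 := by
    rw [hrr2, hX2, hh, hσ2]; field_simp; rw [hw2d]; linear_combination (-lam) * hr
  obtain ⟨J1, S1, hJ1, hS1, eJ1, eg1, ep1, hI1⟩ := cap_split k ((m - 1) / 2) lam d ρ (by linarith) hl0 hd0 haR1
  obtain ⟨J2, S2, hJ2, hS2, eJ2, eg2, ep2, hI2⟩ := cap_split l ((m - 3) / 2) 1 h r (by linarith) one_pos hh0 haR2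
  rw [eg1] at hb1
  rw [eg2] at hb2
  have hfin := combine_alg m lam r3 σ w1 w2 t _ (lam ^ k) J1 S1 J2 S2 hm hr (by linarith) hl0 hσ hw1 hw2 (by positivity)
    ht rfl hJ1 hJ2 hS1 hS2 hb1 hb2
  have x1 : ((l:ℝ) - 1) / 2 = (m - 1) / 2 := by rw [hl']
  have x2 : ((k:ℝ) - 1) / 2 = (m - 3) / 2 := by rw [hk]; ring
  have x3 : ((l:ℝ) + 1) / 2 = (m - 1) / 2 + 1 := by rw [hl']; ring
  have x4 : ((k:ℝ) + 1) / 2 = (m - 3) / 2 + 1 := by rw [hk]; ring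
  rw [x1, x2, x3, x4, eJ1, eJ2]
  obtain ⟨I1, eI1⟩ : ∃ I, I = ∫ u in lam..(ρ - d), u ^ k * (ρ ^ 2 - (u + d) ^ 2) ^ ((m - 1)/2 + 1) := ⟨_, rfl⟩
  obtain ⟨I2, eI2⟩ : ∃ I, I = ∫ u in (1:ℝ)..(r - h), u ^ l * (r ^ 2 - (u + h) ^ 2) ^ ((m - 3)/2 + 1) := ⟨_, rfl⟩
  rw [← eI1] at ep1 hI1 ⊢
  rw [← eI2] at ep2 hI2 ⊢
  have e2 : (lam ^ 2) ^ ((m - 3) / 2 + 1) = lam ^ (k + 1) := by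
    rw [← Real.rpow_natCast lam 2, ← Real.rpow_mul hl0.le, ← Real.rpow_natCast lam (k+1)]
    congr 1
    push_cast
    rw [hk]; ring
  rw [hf1, Real.one_rpow, hg1, hk] at ep1
  rw [hf2, e2, hg2, hl'] at ep2
  obtain ⟨A1, hA1⟩ : ∃ A, A = r3 * σ ^ 2 / w1 * J1 - d * S1 := ⟨_, rfl⟩
  obtain ⟨A2, hA2⟩ : ∃ A, A = r3 * lam * σ ^ 2 / w2 * J2 - h * S2 := ⟨_, rfl⟩
  have hd' : d = σ ^ 2 / w1 := by rw [hσ2, hd]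
  have hh' : h = σ ^ 2 / w2 := by rw [hσ2, hh]
  rw [← hd', ← hh', ← hA1, ← hA2] at hfin
  rw [← hA1] at ep1
  rw [← hA2] at ep2
  have hone : (1:ℝ) ^ (l + 1) = 1 := one_pow _
  have hsum : 2 * m * (lam ^ (k + 1) + (m - 2 + 1) * I1 + (m + 1) * I2) = (m - 1) * (m + 1) * (A1 + A2) := by
    linear_combination (-(m - 1)) * ep1 - (m + 1) * ep2 - (m + 1) * lam ^ (k + 1) * hone
  have eqe : ρ * J1 + r * J2 - lam ^ k * σ / (2 * m - 1) = 2 * σ / w1 * J1 + 2 * lam * σ / w2 * J2 - σ * lam ^ k / (2 * m - 1) := by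
    rw [hρ, hrr]; ring
  refine ⟨_, _, rfl, rfl, ?_, ?_, ?_⟩
  · have : 0 ≤ (k:ℝ) + 1 := by positivity
    have : 0 ≤ (l:ℝ) + 1 := by positivity
    positivity
  · rw [hk, hl', hsum, eqe]
    have := mul_le_mul_of_nonneg_left hfin.1 (show 0 ≤ (m - 1) * (m + 1) from mul_nonneg (by linarith) (by linarith))
    refine this.trans (le_of_eq ?_)
    ring
  · rw [eqe]
    exact hfin.2


lemma s_deriv (q t : ℝ) (hq : 1 ≤ q) :
    HasDerivAt (fun t : ℝ => (1 - t ^ 2) ^ q) (-(2 * t) * q * (1 - t ^ 2) ^ (q - 1)) t := by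
  have h2 : HasDerivAt (fun t : ℝ => 1 - t ^ 2) (-(2 * t)) t := by
    simpa using (hasDerivAt_pow 2 t).const_sub 1
  exact h2.rpow_const (p := q) (Or.inr hq)

lemma s_cont (q : ℝ) (hq : 0 ≤ q) : Continuous (fun t : ℝ => (1 - t ^ 2) ^ q) :=
  Continuous.rpow_const (by fun_prop) (fun _ => Or.inr hq)

lemma plane_parts (p : ℝ) (hp : 1 ≤ p) :
    2 * p * (∫ t in (1/2:ℝ)..1, (1 - t ^ 2) ^ (p - 1)) - 1/2 * (3/4) ^ p =
      (2 * p + 1) * (∫ t in (1/2:ℝ)..1, (1 - t ^ 2) ^ p) := by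
  have hc1 := s_cont p (by linarith)
  have hc2 := s_cont (p - 1) (by linarith)
  have hd : ∀ t ∈ Set.uIcc (1/2:ℝ) 1, HasDerivAt (fun t : ℝ => t * (1 - t ^ 2) ^ p)
      ((2 * p + 1) * (1 - t ^ 2) ^ p - 2 * p * (1 - t ^ 2) ^ (p - 1)) t := by
    intro t ht
    rw [Set.uIcc_of_le (by norm_num)] at ht
    have h0 : 0 ≤ 1 - t ^ 2 := by nlinarith [ht.1, ht.2]
    refine ((hasDerivAt_id t).mul (s_deriv p t hp)).congr_deriv ?_
    have e : (1 - t ^ 2) ^ p = (1 - t ^ 2) ^ (p - 1) * (1 - t ^ 2) := by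
      rw [← Real.rpow_add_one' h0 (by linarith)]; congr 1; ring
    rw [e]; simp only [id]; ring
  have hF := intervalIntegral.integral_eq_sub_of_hasDerivAt hd
    (((hc1.const_mul (2 * p + 1)).sub (hc2.const_mul (2 * p))).intervalIntegrable _ _)
  rw [intervalIntegral.integral_sub ((hc1.const_mul _).intervalIntegrable _ _)
    ((hc2.const_mul _).intervalIntegrable _ _), intervalIntegral.integral_const_mul,
    intervalIntegral.integral_const_mul] at hF
  have e1 : (1 - (1:ℝ) ^ 2) = 0 := by norm_num
  have e2 : (1 - (1/2:ℝ) ^ 2) = 3/4 := by norm_num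
  rw [e1, e2, Real.zero_rpow (by linarith)] at hF
  linarith

lemma plane_lower (p : ℝ) (hp : 1 ≤ p) :
    1/2 * (3/4) ^ (p + 1) * ((2 * p + 1) / ((p + 1) * (p + 2))) ≤ (∫ t in (1/2:ℝ)..1, (1 - t ^ 2) ^ p) := by
  have hc1 := s_cont p (by linarith)
  have hd : ∀ t ∈ Set.uIcc (1/2:ℝ) 1, HasDerivAt
      (fun t : ℝ => 1/(2 * (p + 1)) * (1 - t ^ 2) ^ (p + 1) - 2 / (p + 2) * (1 - t ^ 2) ^ (p + 2))
      (t * (3 - 4 * t ^ 2) * (1 - t ^ 2) ^ p) t := by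
    intro t ht
    rw [Set.uIcc_of_le (by norm_num)] at ht
    have h0 : 0 ≤ 1 - t ^ 2 := by nlinarith [ht.1, ht.2]
    refine (((s_deriv (p + 1) t (by linarith)).const_mul _).sub ((s_deriv (p + 2) t (by linarith)).const_mul _)).congr_deriv ?_
    have e : (1 - t ^ 2) ^ (p + 2 - 1) = (1 - t ^ 2) ^ p * (1 - t ^ 2) := by
      rw [← Real.rpow_add_one' h0 (by linarith)]; congr 1; ring
    rw [e, add_sub_cancel_right]
    field_simp
    ring
  have hci : Continuous (fun t : ℝ => t * (3 - 4 * t ^ 2) * (1 - t ^ 2) ^ p) :=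
    Continuous.mul (by fun_prop) hc1
  have hF := intervalIntegral.integral_eq_sub_of_hasDerivAt hd (hci.intervalIntegrable _ _)
  have e1 : (1 - (1:ℝ) ^ 2) = 0 := by norm_num
  have e2 : (1 - (1/2:ℝ) ^ 2) = 3/4 := by norm_num
  rw [e1, e2, Real.zero_rpow (by linarith), Real.zero_rpow (by linarith)] at hF
  have e3 : (3/4:ℝ) ^ (p + 2) = (3/4) ^ (p + 1) * (3/4) := by
    rw [← Real.rpow_add_one (by norm_num)]; congr 1; ring
  have hle : (∫ t in (1/2:ℝ)..1, t * (3 - 4 * t ^ 2) * (1 - t ^ 2) ^ p) ≤ ∫ t in (1/2:ℝ)..1, (1 - t ^ 2) ^ p := by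
    refine intervalIntegral.integral_mono_on (by norm_num) (hci.intervalIntegrable _ _) (hc1.intervalIntegrable _ _) ?_
    intro t ht
    have h0 : 0 ≤ 1 - t ^ 2 := by nlinarith [ht.1, ht.2]
    have h3 : 0 ≤ (1 - t ^ 2) ^ p := Real.rpow_nonneg h0 p
    have h4 : t * (3 - 4 * t ^ 2) ≤ 1 := by nlinarith [ht.1, ht.2, sq_nonneg (2 * t - 1)]
    nlinarith
  refine le_trans (le_of_eq ?_) hle
  rw [hF, e3]
  field_simp
  ring

lemma gamma_bound (m : ℕ) : 4 ≤ m → Real.Gamma ((m:ℝ) + 1/2) * √π ≤ 35/48 * 2 ^ m * Real.Gamma (((m:ℝ) + 1)/2) ^ 2 := by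
  induction m using Nat.twoStepInduction with
  | zero => intro h; omega
  | one => intro h; omega
  | more j ih _ =>
    intro h
    have hpi : √π * √π = π := Real.mul_self_sqrt Real.pi_pos.le
    by_cases h4 : j = 2
    · subst h4
      have g1 : Real.Gamma (((2 + 2 : ℕ):ℝ) + 1/2) = 105/16 * √π := by
        have : (((2 + 2 : ℕ):ℝ) + 1/2) = 1/2 + 1 + 1 + 1 + 1 := by norm_num
        rw [this, Real.Gamma_add_one (by norm_num), Real.Gamma_add_one (by norm_num), Real.Gamma_add_one (by norm_num), Real.Gamma_add_one (by norm_num), Real.Gamma_one_half_eq]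
        ring
      have g2 : Real.Gamma ((((2 + 2 : ℕ):ℝ) + 1)/2) = 3/4 * √π := by
        have : ((((2 + 2 : ℕ):ℝ) + 1)/2) = 1/2 + 1 + 1 := by norm_num
        rw [this, Real.Gamma_add_one (by norm_num), Real.Gamma_add_one (by norm_num), Real.Gamma_one_half_eq]
        ring
      rw [g1, g2]
      have : (3/4 * √π) ^ 2 = 9/16 * (√π * √π) := by ring
      rw [this, mul_assoc, hpi]
      norm_num
      linarith
    by_cases h5 : j = 3
    · subst h5
      have g1 : Real.Gamma (((3 + 2 : ℕ):ℝ) + 1/2) = 945/32 * √π := by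
        have : (((3 + 2 : ℕ):ℝ) + 1/2) = 1/2 + 1 + 1 + 1 + 1 + 1 := by norm_num
        rw [this, Real.Gamma_add_one (by norm_num), Real.Gamma_add_one (by norm_num), Real.Gamma_add_one (by norm_num), Real.Gamma_add_one (by norm_num), Real.Gamma_add_one (by norm_num), Real.Gamma_one_half_eq]
        ring
      have g2 : Real.Gamma ((((3 + 2 : ℕ):ℝ) + 1)/2) = 2 := by
        have : ((((3 + 2 : ℕ):ℝ) + 1)/2) = 1 + 1 + 1 := by norm_num
        rw [this, Real.Gamma_add_one (by norm_num), Real.Gamma_add_one (by norm_num), Real.Gamma_one]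
        norm_num
      rw [g1, g2, mul_assoc, hpi]
      have := Real.pi_lt_d2
      norm_num
      linarith
    have hj : 4 ≤ j := by omega
    have ih' := ih hj
    have hj0 : (4:ℝ) ≤ j := by exact_mod_cast hj
    have g1 : Real.Gamma (((j + 2 : ℕ):ℝ) + 1/2) = ((j:ℝ) + 3/2) * (((j:ℝ) + 1/2) * Real.Gamma ((j:ℝ) + 1/2)) := by
      have : (((j + 2 : ℕ):ℝ) + 1/2) = (j:ℝ) + 1/2 + 1 + 1 := by push_cast; ring
      rw [this, Real.Gamma_add_one (by positivity), Real.Gamma_add_one (by positivity)]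
      ring
    have g2 : Real.Gamma ((((j + 2 : ℕ):ℝ) + 1)/2) = ((j:ℝ) + 1)/2 * Real.Gamma (((j:ℝ) + 1)/2) := by
      have : ((((j + 2 : ℕ):ℝ) + 1)/2) = ((j:ℝ) + 1)/2 + 1 := by push_cast; ring
      rw [this, Real.Gamma_add_one (by positivity)]
    rw [g1, g2]
    have hG : 0 ≤ 35/48 * 2 ^ j * Real.Gamma (((j:ℝ) + 1)/2) ^ 2 := by positivity
    calc ((j:ℝ) + 3/2) * (((j:ℝ) + 1/2) * Real.Gamma ((j:ℝ) + 1/2)) * √π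
        = (((j:ℝ) + 3/2) * ((j:ℝ) + 1/2)) * (Real.Gamma ((j:ℝ) + 1/2) * √π) := by ring
      _ ≤ (((j:ℝ) + 3/2) * ((j:ℝ) + 1/2)) * (35/48 * 2 ^ j * Real.Gamma (((j:ℝ) + 1)/2) ^ 2) := by gcongr
      _ ≤ ((j:ℝ) + 1) ^ 2 * (35/48 * 2 ^ j * Real.Gamma (((j:ℝ) + 1)/2) ^ 2) := by
          refine mul_le_mul_of_nonneg_right ?_ hG
          nlinarith
      _ = _ := by rw [pow_add]; ring


lemma final_num_s16 (k mm : ℕ) (m lam t b : ℝ) (hmm : (mm:ℝ) = m) (hk : (k:ℝ) = m - 2) (hm : 4 ≤ m)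
    (hl0 : 0 < lam) (hml : m * lam ^ 2 = m - 2)
    (ht : 2 - t = (2 * m + 9/10) / (2 * (2 * m - 1))) (hb : b = 4/9 * t ^ 2 * m / (m - 1)) :
    35/12 * (m - 1) ^ 2 * (m + 1/2) * (m + 3/2) * lam ^ k * b ^ mm < m ^ 3 * (2 * m + 9/10) := by
  have hm1 : 0 < m - 1 := by linarith
  have hm2 : 0 < m - 2 := by linarith
  have h2m : 0 < 2 * m - 1 := by linarith
  have hne : m * 2 - 1 ≠ 0 := by linarith
  have htt : t = (6 * m - 49/10) / (2 * (2 * m - 1)) := by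
    have : t = 2 - (2 * m + 9/10) / (2 * (2 * m - 1)) := by linarith
    rw [this]; field_simp; ring
  have hb0 : 0 ≤ b := by rw [hb]; positivity
  have hb1 : m * (b - 1) = m * (66/5 * m ^ 2 - 2099/100 * m + 9) / (9 * (2 * m - 1) ^ 2 * (m - 1)) := by
    rw [hb, htt]; field_simp; ring
  have hlam : lam ≤ exp (-1 / (m - 1)) := by
    have h1 := Real.le_log_one_add_of_nonneg (x := 2 / (m - 2)) (by positivity)
    have e1 : 2 * (2 / (m - 2)) / (2 / (m - 2) + 2) = 2 / (m - 1) := by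
      field_simp; ring
    have e2 : 1 + 2 / (m - 2) = (lam ^ 2)⁻¹ := by
      have : lam ^ 2 = (m - 2) / m := by field_simp; linarith
      rw [this]; field_simp; ring
    rw [e1, e2, Real.log_inv] at h1
    have h2 : lam ^ 2 ≤ exp (-1 / (m - 1)) ^ 2 := by
      rw [← Real.exp_nat_mul, ← Real.log_le_iff_le_exp (by positivity)]
      refine le_trans (by linarith : log (lam ^ 2) ≤ -(2 / (m - 1))) (le_of_eq ?_)
      push_cast; ring
    exact abs_le_of_sq_le_sq' h2 (exp_pos _).le |>.2
  have hlk : lam ^ k ≤ exp (-((m - 2) / (m - 1))) := by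
    refine (pow_le_pow_left₀ hl0.le hlam k).trans (le_of_eq ?_)
    rw [← Real.exp_nat_mul, hk]; congr 1; ring
  have hbk : b ^ mm ≤ exp (m * (b - 1)) := by
    have : b ≤ exp (b - 1) := by linarith [Real.add_one_le_exp (b - 1)]
    refine (pow_le_pow_left₀ hb0 this mm).trans (le_of_eq ?_)
    rw [← Real.exp_nat_mul, hmm]
  obtain ⟨y, hy⟩ : ∃ y, y = (m - 2) / (m - 1) - m * (b - 1) := ⟨_, rfl⟩
  have hprod : lam ^ k * b ^ mm ≤ exp (-y) := by
    calc lam ^ k * b ^ mm ≤ exp (-((m - 2) / (m - 1))) * exp (m * (b - 1)) := by gcongr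
      _ = exp (-y) := by rw [← Real.exp_add, hy]; congr 1; ring
  have hy1 : y = ((m - 2) * (9 * (2 * m - 1) ^ 2) - m * (66/5 * m ^ 2 - 2099/100 * m + 9)) / (9 * (2 * m - 1) ^ 2 * (m - 1)) := by
    rw [hy, hb1]; field_simp
  have hkey : 35/12 * (m - 1) ^ 2 * (m + 1/2) * (m + 3/2) < m ^ 3 * (2 * m + 9/10) * (1 + y) := by
    have e1 : 1 + y = (9 * (2 * m - 1) ^ 2 * (m - 1) + ((m - 2) * (9 * (2 * m - 1) ^ 2) - m * (66/5 * m ^ 2 - 2099/100 * m + 9))) / (9 * (2 * m - 1) ^ 2 * (m - 1)) := by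
      rw [hy1]; field_simp
    rw [e1, ← mul_div_assoc, lt_div_iff₀ (by positivity)]
    obtain ⟨j, hj⟩ : ∃ j, j = m - 4 := ⟨_, rfl⟩
    have hj0 : 0 ≤ j := by linarith
    have : m = j + 4 := by linarith
    rw [this]
    rw [← sub_pos]
    ring_nf
    positivity
  have hy0 : 0 < 1 + y := by
    by_contra hc
    push Not at hc
    have : m ^ 3 * (2 * m + 9/10) * (1 + y) ≤ 0 := mul_nonpos_of_nonneg_of_nonpos (by positivity) hc
    have : 0 < 35/12 * (m - 1) ^ 2 * (m + 1/2) * (m + 3/2) := by positivity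
    linarith
  have hexp : exp (-y) * (1 + y) ≤ 1 := by
    rw [Real.exp_neg, inv_mul_le_iff₀ (exp_pos _)]
    linarith [Real.add_one_le_exp y]
  calc 35/12 * (m - 1) ^ 2 * (m + 1/2) * (m + 3/2) * lam ^ k * b ^ mm
      = 35/12 * (m - 1) ^ 2 * (m + 1/2) * (m + 3/2) * (lam ^ k * b ^ mm) := by ring
    _ ≤ 35/12 * (m - 1) ^ 2 * (m + 1/2) * (m + 3/2) * exp (-y) := by gcongr
    _ < m ^ 3 * (2 * m + 9/10) * (1 + y) * exp (-y) := by gcongr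
    _ = m ^ 3 * (2 * m + 9/10) * (exp (-y) * (1 + y)) := by ring
    _ ≤ m ^ 3 * (2 * m + 9/10) * 1 := by gcongr
    _ = _ := by ring


lemma last_step (N : ℕ) (E V U c Vp q : ℝ) (hq : q = N / ((N:ℝ) + 1)) (hV : 0 < V) (hVp : 0 < Vp)
    (hc : 0 < c) (hE1 : E ≤ c * (((N:ℝ) + 1) * V)) (hE2 : E ≤ U) (hU : U * c ^ N < ((N:ℝ) + 1) * Vp) :
    E / V ^ q < ((N:ℝ) + 1) * Vp / Vp ^ q := by
  have hR : 0 < ((N:ℝ) + 1) * Vp / Vp ^ q := by positivity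
  rcases le_or_gt E 0 with h0 | h0
  · refine lt_of_le_of_lt ?_ hR
    exact div_nonpos_of_nonpos_of_nonneg h0 (by positivity)
  have key : ∀ x : ℝ, 0 < x → (x ^ q) ^ (N + 1) = x ^ N := by
    intro x hx
    rw [← Real.rpow_natCast, ← Real.rpow_mul hx.le, ← Real.rpow_natCast x N]
    congr 1
    rw [hq]; push_cast; field_simp
  refine lt_of_pow_lt_pow_left₀ (N + 1) hR.le ?_
  rw [div_pow, div_pow, key V hV, key Vp hVp, div_lt_iff₀ (by positivity)]
  have hEN : E ^ N ≤ (c * (((N:ℝ) + 1) * V)) ^ N := pow_le_pow_left₀ h0.le hE1 N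
  have hU0 : 0 < U := by linarith
  have e1 : (((N:ℝ) + 1) * Vp) ^ (N + 1) / Vp ^ N * V ^ N = ((N:ℝ) + 1) ^ N * V ^ N * (((N:ℝ) + 1) * Vp) := by
    rw [mul_pow, pow_succ, pow_succ]; field_simp
  rw [e1]
  calc E ^ (N + 1) = E ^ N * E := pow_succ _ _
    _ ≤ (c * (((N:ℝ) + 1) * V)) ^ N * U := by gcongr
    _ = ((N:ℝ) + 1) ^ N * V ^ N * (U * c ^ N) := by rw [mul_pow, mul_pow]; ring
    _ < _ := by gcongr

lemma omega_bound (m : ℕ) (hm : 4 ≤ m) :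
    π ^ (((m:ℝ) - 1)/2) / Real.Gamma (((m:ℝ) + 1)/2) * (π ^ (((m:ℝ) + 1)/2) / Real.Gamma (((m:ℝ) + 1)/2 + 1))
      ≤ π ^ ((m:ℝ) - 1/2) / Real.Gamma ((m:ℝ) + 1/2) * (35/24 * 2 ^ m / ((m:ℝ) + 1)) := by
  have hg := gamma_bound m hm
  have hm0 : (0:ℝ) < m := by exact_mod_cast (by omega : 0 < m)
  have hG : 0 < Real.Gamma (((m:ℝ) + 1)/2) := Real.Gamma_pos_of_pos (by positivity)
  have hA : 0 < Real.Gamma ((m:ℝ) + 1/2) := Real.Gamma_pos_of_pos (by positivity)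
  rw [Real.Gamma_add_one (by positivity)]
  obtain ⟨G, hGd⟩ : ∃ G, G = Real.Gamma (((m:ℝ) + 1)/2) := ⟨_, rfl⟩
  obtain ⟨A, hAd⟩ : ∃ A, A = Real.Gamma ((m:ℝ) + 1/2) := ⟨_, rfl⟩
  rw [← hGd] at hg hG ⊢
  rw [← hAd] at hg hA ⊢
  have hs : 0 < √π := Real.sqrt_pos.mpr Real.pi_pos
  have hpp : π ^ (((m:ℝ) - 1)/2) * π ^ (((m:ℝ) + 1)/2) = π ^ ((m:ℝ) - 1/2) * √π := by
    rw [Real.sqrt_eq_rpow, ← Real.rpow_add Real.pi_pos, ← Real.rpow_add Real.pi_pos]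
    congr 1; ring
  have e1 : π ^ (((m:ℝ) - 1)/2) / G * (π ^ (((m:ℝ) + 1)/2) / (((m:ℝ) + 1)/2 * G)) =
      π ^ ((m:ℝ) - 1/2) * (2 * √π / (((m:ℝ) + 1) * G ^ 2)) := by
    have : π ^ (((m:ℝ) - 1)/2) / G * (π ^ (((m:ℝ) + 1)/2) / (((m:ℝ) + 1)/2 * G)) =
      (π ^ (((m:ℝ) - 1)/2) * π ^ (((m:ℝ) + 1)/2)) * (2 / (((m:ℝ) + 1) * G ^ 2)) := by
      field_simp
    rw [this, hpp]; ring
  have e3 : π ^ ((m:ℝ) - 1/2) / A * (35/24 * 2 ^ m / ((m:ℝ) + 1)) =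
      π ^ ((m:ℝ) - 1/2) * (35/24 * 2 ^ m / ((m:ℝ) + 1) / A) := by ring
  rw [e1, e3]
  refine mul_le_mul_of_nonneg_left ?_ (by positivity)
  rw [div_le_div_iff₀ (by positivity) (by positivity)]
  have e2 : 35/24 * 2 ^ m / ((m:ℝ) + 1) * (((m:ℝ) + 1) * G ^ 2) = 2 * (35/48 * 2 ^ m * G ^ 2) := by
    field_simp; norm_num
  rw [e2]
  linarith

lemma trig_facts (lam σ : ℝ) (hσ : σ = √(1 + lam ^ 2)) (hw1 : 0 < √3 - lam) (hw2 : 0 < √3 * lam - 1) :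
    lam * Real.tan (2 * π / 3 - arctan lam) - 1 = (1 + lam ^ 2) / (√3 * lam - 1) ∧
    lam / Real.cos (2 * π / 3 - arctan lam) = 2 * lam * σ / (√3 * lam - 1) ∧
    Real.tan (π / 6 + arctan lam) - lam = (1 + lam ^ 2) / (√3 - lam) ∧
    1 / Real.cos (π / 6 + arctan lam) = 2 * σ / (√3 - lam) := by
  have hσ0 : 0 < σ := by rw [hσ]; positivity
  have hc : Real.cos (arctan lam) = 1 / σ := by rw [Real.cos_arctan, hσ]
  have hs : Real.sin (arctan lam) = lam / σ := by rw [Real.sin_arctan, hσ]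
  have h23 : 2 * π / 3 = π - π / 3 := by ring
  have c1 : Real.cos (2 * π / 3 - arctan lam) = (√3 * lam - 1) / (2 * σ) := by
    rw [h23, Real.cos_sub, Real.cos_pi_sub, Real.sin_pi_sub, Real.cos_pi_div_three, Real.sin_pi_div_three, hc, hs]
    field_simp; ring
  have s1 : Real.sin (2 * π / 3 - arctan lam) = (√3 + lam) / (2 * σ) := by
    rw [h23, Real.sin_sub, Real.cos_pi_sub, Real.sin_pi_sub, Real.cos_pi_div_three, Real.sin_pi_div_three, hc, hs]
    field_simp; ring
  have c2 : Real.cos (π / 6 + arctan lam) = (√3 - lam) / (2 * σ) := by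
    rw [Real.cos_add, Real.cos_pi_div_six, Real.sin_pi_div_six, hc, hs]
    field_simp
  have s2 : Real.sin (π / 6 + arctan lam) = (1 + √3 * lam) / (2 * σ) := by
    rw [Real.sin_add, Real.cos_pi_div_six, Real.sin_pi_div_six, hc, hs]
    field_simp
  obtain ⟨w1, hw1d⟩ : ∃ w, w = √3 - lam := ⟨_, rfl⟩
  obtain ⟨w2, hw2d⟩ : ∃ w, w = √3 * lam - 1 := ⟨_, rfl⟩
  rw [Real.tan_eq_sin_div_cos, Real.tan_eq_sin_div_cos, c1, s1, c2, s2]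
  rw [← hw1d] at hw1 ⊢
  rw [← hw2d] at hw2 ⊢
  refine ⟨?_, ?_, ?_, ?_⟩
  · field_simp; rw [hw2d]; ring
  · field_simp
  · field_simp; rw [hw1d]; ring
  · field_simp

lemma plane_value (m : ℕ) (hm : 4 ≤ m) (ω : ℝ) (hω : 0 < ω) :
    ∃ Vp : ℝ, 2 * ω * (∫ t in (1/2:ℝ)..1, (1 - t ^ 2) ^ ((m:ℝ) - 1/2)) = Vp ∧ 0 < Vp ∧
      2 * ω * √3 * (3/4) ^ m * m ^ 2 / (((m:ℝ) + 1/2) * (m + 3/2)) ≤ 2 * m * Vp ∧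
      2 * (2 * (m:ℝ) - 1) * ω * (∫ t in (1/2:ℝ)..1, (1 - t ^ 2) ^ ((m:ℝ) - 1/2 - 1))
      - ω * (√3 / 2) ^ (2 * (m:ℝ) - 1) = 2 * m * Vp := by
  have hm4 : (4:ℝ) ≤ m := by exact_mod_cast hm
  have h1 := plane_parts ((m:ℝ) - 1/2) (by linarith)
  have h2 := plane_lower ((m:ℝ) - 1/2) (by linarith)
  have e1 : (3/4:ℝ) ^ ((m:ℝ) - 1/2 + 1) = (3/4) ^ m * (√3 / 2) := by
    have : (m:ℝ) - 1/2 + 1 = m + 1/2 := by ring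
    rw [this, Real.rpow_add (by norm_num), Real.rpow_natCast, ← Real.sqrt_eq_rpow, Real.sqrt_div (by norm_num)]
    congr 2
    rw [show (4:ℝ) = 2 ^ 2 by norm_num, Real.sqrt_sq (by norm_num)]
  have e2 : (√3 / 2) ^ (2 * (m:ℝ) - 1) = (3/4:ℝ) ^ ((m:ℝ) - 1/2) := by
    have : (3/4:ℝ) = (√3 / 2) ^ (2:ℝ) := by
      rw [Real.rpow_two, div_pow, Real.sq_sqrt (by norm_num)]; norm_num
    rw [this, ← Real.rpow_mul (by positivity)]
    congr 1; ring
  rw [e1] at h2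
  obtain ⟨I, hI⟩ : ∃ I, I = ∫ t in (1/2:ℝ)..1, (1 - t ^ 2) ^ ((m:ℝ) - 1/2) := ⟨_, rfl⟩
  rw [← hI] at h1 h2 ⊢
  have hI0 : 0 < I := by
    refine lt_of_lt_of_le ?_ h2
    have : (0:ℝ) < 2 * (m - 1/2) + 1 := by linarith
    have : (0:ℝ) < m - 1/2 + 1 := by linarith
    have : (0:ℝ) < m - 1/2 + 2 := by linarith
    positivity
  refine ⟨_, rfl, by positivity, ?_, ?_⟩
  · have h3 := mul_le_mul_of_nonneg_left h2 (show 0 ≤ 4 * ω * m by positivity)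
    refine le_trans (le_of_eq ?_) (h3.trans (le_of_eq ?_))
    · rw [show (m:ℝ) - 1/2 + 1 = m + 1/2 by ring, show (m:ℝ) - 1/2 + 2 = m + 3/2 by ring, show 2 * ((m:ℝ) - 1/2) + 1 = 2 * m by ring]
      ring
    · ring
  · rw [e2]
    linear_combination (2 * ω) * h1

lemma main_ineq (k m : ℕ) (lam σ t W ω Vp : ℝ) (hk : (k:ℝ) = (m:ℝ) - 2) (hm : (4:ℝ) ≤ m)
    (hl0 : 0 < lam) (hml : (m:ℝ) * lam ^ 2 = (m:ℝ) - 2) (hσ : 0 < σ) (hσ2 : σ ^ 2 = 1 + lam ^ 2)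
    (ht : 2 - t = (2 * (m:ℝ) + 9/10) / (2 * (2 * (m:ℝ) - 1))) (ht0 : 0 < t) (hω : 0 < ω)
    (hW : W ≤ ω * (35/24 * 2 ^ m / ((m:ℝ) + 1)))
    (hVp : 2 * ω * √3 * (3/4) ^ m * m ^ 2 / (((m:ℝ) + 1/2) * (m + 3/2)) ≤ 2 * m * Vp) :
    W * (((m:ℝ) - 1) * ((m:ℝ) + 1)) * (σ * lam ^ k * (2 * t / (2 * (m:ℝ) + 9/10))) * (t / (√3 * σ)) ^ (2 * m - 1)
      < 2 * m * Vp := by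
  have hm1 : 0 < (m:ℝ) - 1 := by linarith
  have hm0 : 0 < (m:ℝ) := by linarith
  have h3 : √3 ^ 2 = 3 := Real.sq_sqrt (by norm_num)
  have h30 : 0 < √3 := by positivity
  have hfn := final_num_s16 k m m lam t _ rfl hk hm hl0 hml ht rfl
  obtain ⟨b, hb⟩ : ∃ b, b = 4/9 * t ^ 2 * m / ((m:ℝ) - 1) := ⟨_, rfl⟩
  rw [← hb] at hfn
  have hb0 : 0 < b := by rw [hb]; positivity
  have hσm : σ ^ 2 * m = 2 * ((m:ℝ) - 1) := by rw [hσ2]; linarith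
  obtain ⟨c, hc⟩ : ∃ c, c = t / (√3 * σ) := ⟨_, rfl⟩
  have hc0 : 0 < c := by rw [hc]; positivity
  have hct : c * (√3 * σ) = t := by rw [hc]; field_simp
  have hc2 : 2 * c ^ 2 = 3/4 * b := by
    have e1 : c ^ 2 * (3 * σ ^ 2) = t ^ 2 := by rw [← hct, mul_pow, mul_pow, h3]
    have e2 : b * ((m:ℝ) - 1) = 4/9 * t ^ 2 * m := by rw [hb]; field_simp
    have e3 : (2 * c ^ 2) * ((m:ℝ) - 1) = (3/4 * b) * ((m:ℝ) - 1) := by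
      linear_combination (-3/4) * e2 + (m / 3) * e1 - c ^ 2 * hσm
    exact mul_right_cancel₀ hm1.ne' e3
  rw [← hc]
  have hpow : t * c ^ (2 * m - 1) = √3 * σ * (c ^ 2) ^ m := by
    rw [← pow_mul]
    have : 2 * m = (2 * m - 1) + 1 := by
      have : 0 < m := by exact_mod_cast hm0
      omega
    conv_rhs => rw [this, pow_succ]
    rw [← hct]; ring
  have hpos : 0 ≤ (((m:ℝ) - 1) * ((m:ℝ) + 1)) * (σ * lam ^ k * (2 * t / (2 * (m:ℝ) + 9/10))) * c ^ (2 * m - 1) := by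
    positivity
  have hpw : (2:ℝ) ^ m * (c ^ 2) ^ m = (3/4) ^ m * b ^ m := by
    rw [← mul_pow, ← mul_pow, hc2]
  calc W * (((m:ℝ) - 1) * ((m:ℝ) + 1)) * (σ * lam ^ k * (2 * t / (2 * (m:ℝ) + 9/10))) * c ^ (2 * m - 1)
      = W * ((((m:ℝ) - 1) * ((m:ℝ) + 1)) * (σ * lam ^ k * (2 * t / (2 * (m:ℝ) + 9/10))) * c ^ (2 * m - 1)) := by ring
    _ ≤ ω * (35/24 * 2 ^ m / ((m:ℝ) + 1)) * ((((m:ℝ) - 1) * ((m:ℝ) + 1)) * (σ * lam ^ k * (2 * t / (2 * (m:ℝ) + 9/10))) * c ^ (2 * m - 1)) :=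
        mul_le_mul_of_nonneg_right hW hpos
    _ = ω * (35/12) * ((m:ℝ) - 1) * lam ^ k * σ / (2 * (m:ℝ) + 9/10) * 2 ^ m * (t * c ^ (2 * m - 1)) := by
        field_simp; norm_num
    _ = ω * (35/12) * ((m:ℝ) - 1) * lam ^ k * √3 / (2 * (m:ℝ) + 9/10) * (2 ^ m * (c ^ 2) ^ m) * (σ ^ 2 * m) / m := by
        rw [hpow]; field_simp
    _ = 2 * ω * √3 * (3/4) ^ m / ((2 * (m:ℝ) + 9/10) * m * (((m:ℝ) + 1/2) * (m + 3/2))) * (35/12 * ((m:ℝ) - 1) ^ 2 * ((m:ℝ) + 1/2) * ((m:ℝ) + 3/2) * lam ^ k * b ^ m) := by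
        rw [hpw, hσm]; field_simp
    _ < 2 * ω * √3 * (3/4) ^ m / ((2 * (m:ℝ) + 9/10) * m * (((m:ℝ) + 1/2) * (m + 3/2))) * ((m:ℝ) ^ 3 * (2 * m + 9/10)) := by
        gcongr
    _ = 2 * ω * √3 * (3/4) ^ m * m ^ 2 / (((m:ℝ) + 1/2) * (m + 3/2)) := by
        field_simp
    _ ≤ _ := hVp

theorem M_offdiag_lt_lambdaPlane_even (n : ℕ) (hn : Even n) (h8 : 8 ≤ n) (h2700 : n ≤ 2700) :
    lawsonCompetitorEnergy (n / 2 - 1 - 1) (n / 2 - 1 + 1) < lambdaPlane n := by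
  obtain ⟨m, rfl⟩ := hn
  have hm4 : 4 ≤ m := by omega
  have hm : (4:ℝ) ≤ m := by exact_mod_cast hm4
  obtain ⟨k, hkm⟩ : ∃ k, m = k + 2 := ⟨m - 2, by omega⟩
  have x1 : (m + m) / 2 - 1 - 1 = k := by omega
  have x2 : (m + m) / 2 - 1 + 1 = m := by omega
  rw [x1, x2]
  have hk : (k:ℝ) = (m:ℝ) - 2 := by rw [hkm]; push_cast; ring
  have hm0 : (0:ℝ) < m := by linarith
  have hk0 : (0:ℝ) < k := by rw [hk]; linarith
  obtain ⟨lam, hlam⟩ : ∃ lam, lam = √((k:ℝ) / (m:ℝ)) := ⟨_, rfl⟩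
  have hlam0 : 0 < lam := by rw [hlam]; positivity
  have hlam2 : lam ^ 2 = (k:ℝ) / (m:ℝ) := by rw [hlam]; exact Real.sq_sqrt (by positivity)
  have hml : (m:ℝ) * lam ^ 2 = (m:ℝ) - 2 := by rw [hlam2, ← hk]; field_simp
  have hl5 : 1/2 ≤ lam ^ 2 := by
    rw [hlam2, le_div_iff₀ hm0]; linarith
  have hl1' : lam ^ 2 ≤ 1 := by
    rw [hlam2, div_le_one hm0]; linarith
  have hl : 7/10 ≤ lam := by nlinarith
  have hl1 : lam ≤ 1 := by nlinarith
  have hl7 : 0.707 ≤ lam := by nlinarith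
  have h3 : √3 ^ 2 = 3 := Real.sq_sqrt (by norm_num)
  have h31 : 1.732 < √3 := by
    rw [Real.lt_sqrt (by norm_num)]; norm_num
  have h32 : √3 < 1.7321 := by
    rw [Real.sqrt_lt' (by norm_num)]; norm_num
  have hw1 : 0 < √3 - lam := by linarith
  have hw2 : 0 < √3 * lam - 1 := by nlinarith
  obtain ⟨σ, hσ⟩ : ∃ σ, σ = √(1 + lam ^ 2) := ⟨_, rfl⟩
  have hσ0 : 0 < σ := by rw [hσ]; positivity
  have hσ2 : σ ^ 2 = 1 + lam ^ 2 := by rw [hσ]; exact Real.sq_sqrt (by positivity)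
  obtain ⟨t1, t2, t3, t4⟩ := trig_facts lam σ hσ hw1 hw2
  obtain ⟨t, ht⟩ : ∃ t : ℝ, 2 - t = (2 * (m:ℝ) + 9/10) / (2 * (2 * (m:ℝ) - 1)) := ⟨2 - (2 * (m:ℝ) + 9/10) / (2 * (2 * (m:ℝ) - 1)), by ring⟩
  have ht0 : 0 < t := by
    have : (2 * (m:ℝ) + 9/10) / (2 * (2 * (m:ℝ) - 1)) < 2 := by
      rw [div_lt_iff₀ (by linarith)]; linarith
    linarith
  obtain ⟨e, v, he, hv, hv0, hcA, hcB⟩ := combine k m m lam (√3) σ t _ _ _ _ hk rfl hm hml h3 h31 h32 hl hl1 hσ0 hσ2 ht t3 t4 t1 t2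
  obtain ⟨ω, hω⟩ : ∃ ω, ω = π ^ ((m:ℝ) - 1/2) / Real.Gamma ((m:ℝ) + 1/2) := ⟨_, rfl⟩
  have hω0 : 0 < ω := by
    have := Real.Gamma_pos_of_pos (show 0 < (m:ℝ) + 1/2 by positivity)
    rw [hω]; positivity
  obtain ⟨Vp, hVp, hVp0, hVpl, hVpe⟩ := plane_value m hm4 ω hω0
  have hob := omega_bound m hm4
  rw [← hω] at hob
  have hG1 := Real.Gamma_pos_of_pos (show 0 < ((m:ℝ) + 1)/2 by positivity)
  have hG2 := Real.Gamma_pos_of_pos (show 0 < ((m:ℝ) + 1)/2 + 1 by positivity)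
  have y1 : ((k:ℝ) + 1)/2 = ((m:ℝ) - 1)/2 := by rw [hk]; ring
  have y2 : ((m:ℝ) - 1)/2 + 1 = ((m:ℝ) + 1)/2 := by ring
  obtain ⟨W, hWd⟩ : ∃ W, W = π ^ (((k:ℝ) + 1)/2) / Real.Gamma (((k:ℝ) + 1)/2 + 1) * (π ^ (((m:ℝ) + 1)/2) / Real.Gamma (((m:ℝ) + 1)/2 + 1)) := ⟨_, rfl⟩
  have hW0 : 0 < W := by rw [hWd, y1, y2]; positivity
  have hWe : W = π ^ (((m:ℝ) - 1)/2) / Real.Gamma (((m:ℝ) + 1)/2) * (π ^ (((m:ℝ) + 1)/2) / Real.Gamma (((m:ℝ) + 1)/2 + 1)) := by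
    rw [hWd, y1, y2]
  rw [← hWe] at hob
  have hmain := main_ineq k m lam σ t W ω Vp hk hm hlam0 hml hσ0 hσ2 ht ht0 hω0 hob hVpl
  have hN : ((2 * m - 1 : ℕ) : ℝ) = 2 * (m:ℝ) - 1 := by
    rw [Nat.cast_sub (by omega)]; push_cast; ring
  have hN1 : ((2 * m - 1 : ℕ) : ℝ) + 1 = 2 * (m:ℝ) := by rw [hN]; ring
  have hfin := last_step (2 * m - 1) (W * (((m:ℝ) - 1) * ((m:ℝ) + 1)) * e) (W * v)
    (W * (((m:ℝ) - 1) * ((m:ℝ) + 1)) * (σ * lam ^ k * (2 * t / (2 * (m:ℝ) + 9/10)))) (t / (√3 * σ)) Vp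
    ((2 * (m:ℝ) - 1) / (2 * (m:ℝ))) (by rw [hN1, hN]) (by positivity) hVp0 (by positivity)
    (by
      rw [hN1]
      have := mul_le_mul_of_nonneg_left hcA hW0.le
      refine le_trans (le_of_eq ?_) (this.trans (le_of_eq ?_)) <;> ring)
    (by
      refine mul_le_mul_of_nonneg_left hcB ?_
      have : 0 ≤ (m:ℝ) - 1 := by linarith
      positivity)
    (by rw [hN1]; exact hmain)
  rw [hN1] at hfin
  have hL : lawsonCompetitorEnergy k m = W * (((m:ℝ) - 1) * ((m:ℝ) + 1)) * e / (W * v) ^ ((2 * (m:ℝ) - 1) / (2 * (m:ℝ))) := by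
    unfold lawsonCompetitorEnergy
    simp only
    rw [← hlam, ← hσ, ← hWd, hv, ← he, hk]
    congr 1
    · rw [show (m:ℝ) - 2 + m + 1 = 2 * m - 1 by ring]
      ring
    · congr 1
      rw [show (m:ℝ) - 2 + m + 2 = 2 * m by ring]
  have hP : lambdaPlane (m + m) = 2 * (m:ℝ) * Vp / Vp ^ ((2 * (m:ℝ) - 1) / (2 * (m:ℝ))) := by
    unfold lambdaPlane
    simp only
    have z0 : ((m + m : ℕ) : ℝ) = 2 * (m:ℝ) := by push_cast; ring
    rw [z0]
    have z1 : (2 * (m:ℝ) - 1) / 2 = (m:ℝ) - 1/2 := by ring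
    have z2 : (2 * (m:ℝ) + 1) / 2 = (m:ℝ) + 1/2 := by ring
    have z3 : (2 * (m:ℝ) - 3) / 2 = (m:ℝ) - 1/2 - 1 := by ring
    rw [z1, z2, z3, ← hω, hVp, hVpe]
  rw [hL, hP]
  exact hfin
end
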